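/- Let F be a d-dimensional inner product distribution with (A,X) ~ RDPG(F,n) and X̂ = ASE(A,d). Let F_n = n^{-1} Σ_{i=1}^n δ_{Xᵢ} be the empirical distribution of the true latent positions and F̂_n = n^{-1} Σ_{i=1}^n δ_{X̂ᵢ} the empirical distribution of the estimated positions, and conditional on (A,X) generate A* ~ RDPG(F_n,n) and Â* ~ RDPG(F̂_n,n). Then for every p ≥ 1, W_{GM,p}^p(A*, Â*) = O(n^{-1/2} log n). -/

import Mathlib

open MeasureTheory Filter Matrix
open scoped BigOperators NNReal ENNReal Topology Classical

noncomputable section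

/-- Dot product on `Fin d → ℝ`. -/
def dotd {d : ℕ} (x y : Fin d → ℝ) : ℝ := ∑ k, x k * y k

/-- Euclidean norm on `Fin d → ℝ`. -/
def euclNorm {d : ℕ} (x : Fin d → ℝ) : ℝ := Real.sqrt (∑ k, (x k) ^ 2)

/-- Support of a measure on a topological space. -/
def msupport {α : Type*} [TopologicalSpace α] [MeasurableSpace α] (μ : Measure α) : Set α :=
  {x | ∀ U : Set α, IsOpen U → x ∈ U → 0 < μ U}

/-- `F` is a `d`-dimensional inner product distribution. -/
def InnerProductDistribution (d : ℕ) (F : Measure (Fin d → ℝ)) : Prop :=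
  IsProbabilityMeasure F ∧
    ∀ x ∈ msupport F, ∀ y ∈ msupport F, 0 ≤ dotd x y ∧ dotd x y ≤ 1

/-- Auxiliary i.i.d. uniform randomness on `[0,1]`, indexed by pairs of vertices. -/
def pairUniform (n : ℕ) : Measure ((Fin n × Fin n) → ℝ) :=
  Measure.pi fun _ => volume.restrict (Set.Icc (0:ℝ) 1)

/-- The adjacency matrix built from latent positions `X`, sparsity scale `ρ`, and auxiliary
uniform variables `u`: conditional on `X`, the entries above the diagonal are independent
`Bernoulli(ρ ⟨X i, X j⟩)`, and the matrix is symmetric and hollow. -/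
def adjOf {d n : ℕ} (ρ : ℝ) (X : Fin n → Fin d → ℝ) (u : (Fin n × Fin n) → ℝ) :
    Fin n → Fin n → ℝ := fun i j =>
  if i = j then 0 else if u (min i j, max i j) < ρ * dotd (X i) (X j) then 1 else 0

/-- The joint law of `(A, X)` for a (possibly sparse) random dot product graph whose latent
positions have joint law `μX`. -/
def rdpgLawOf {d n : ℕ} (ρ : ℝ) (μX : Measure (Fin n → Fin d → ℝ)) :
    Measure ((Fin n → Fin n → ℝ) × (Fin n → Fin d → ℝ)) :=
  Measure.map (fun p => (adjOf ρ p.2 p.1, p.2)) ((pairUniform n).prod μX)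

/-- The joint law of `(A,X) ~ RDPG(F, n)`. -/
def rdpgLaw (d n : ℕ) (F : Measure (Fin d → ℝ)) [SigmaFinite F] :
    Measure ((Fin n → Fin n → ℝ) × (Fin n → Fin d → ℝ)) :=
  rdpgLawOf 1 (Measure.pi fun _ : Fin n => F)

/-- `(A, X) ~ RDPG(F, n)` for random variables `A, X` on a probability space `(Ω, P)`. -/
def HasRDPGLaw {Ω : Type*} [MeasurableSpace Ω] (P : Measure Ω) {d n : ℕ}
    (F : Measure (Fin d → ℝ)) [SigmaFinite F] (A : Ω → Fin n → Fin n → ℝ)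
    (X : Ω → Fin n → Fin d → ℝ) : Prop :=
  Measure.map (fun ω => (A ω, X ω)) P = rdpgLaw d n F

/-- The marginal law of the adjacency matrix of an `RDPG(F,n)`. -/
def adjLaw (d n : ℕ) (F : Measure (Fin d → ℝ)) [SigmaFinite F] :
    Measure (Fin n → Fin n → ℝ) :=
  (rdpgLaw d n F).map Prod.fst

/-- The law of the adjacency matrix for fixed latent positions `x`. -/
def adjLawFixed {d : ℕ} (n : ℕ) (x : Fin n → Fin d → ℝ) : Measure (Fin n → Fin n → ℝ) :=
  Measure.map (fun u => adjOf 1 x u) (pairUniform n)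

/-- `Xh` is an adjacency spectral embedding of `A` into dimension `d`: its columns are
orthonormal eigenvectors of `A` corresponding to the `d` largest-in-magnitude eigenvalues,
scaled by the square roots of the absolute eigenvalues. -/
def IsASE {n d : ℕ} (A : Fin n → Fin n → ℝ) (Xh : Fin n → Fin d → ℝ) : Prop :=
  ∃ (lam : Fin d → ℝ) (U : Fin n → Fin d → ℝ),
    (∀ j j', (∑ i, U i j * U i j') = if j = j' then (1:ℝ) else 0) ∧
    (∀ j, (Matrix.of A).mulVec (fun i => U i j) = fun i => lam j * U i j) ∧
    (∀ (mu : ℝ) (v : Fin n → ℝ), v ≠ 0 → (Matrix.of A).mulVec v = mu • v →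
      (∀ j, (∑ i, v i * U i j) = 0) → ∀ j, |mu| ≤ |lam j|) ∧
    (∀ i j, Xh i j = U i j * Real.sqrt |lam j|)

/-- A choice of adjacency spectral embedding of `A` into dimension `d`. -/
def ase (d : ℕ) {n : ℕ} (A : Fin n → Fin n → ℝ) : Fin n → Fin d → ℝ :=
  if h : ∃ Xh, IsASE A Xh then h.choose else 0

/-- The U-statistic with kernel `h` of the points `Y 1, …, Y n`. -/
def Ustat {d : ℕ} (m n : ℕ) (h : (Fin m → Fin d → ℝ) → ℝ) (Y : Fin n → Fin d → ℝ) : ℝ :=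
  ((n.choose m : ℝ))⁻¹ * ∑ c : Fin m → Fin n,
    if StrictMono c then h (fun k => Y (c k)) else 0

/-- The weighted (bootstrapped) U-statistic with kernel `h` and weights `W` (indexed by the
strictly increasing `m`-tuples). -/
def UstatW {d : ℕ} (m n : ℕ) (h : (Fin m → Fin d → ℝ) → ℝ)
    (W : (Fin m → Fin n) → ℝ) (Y : Fin n → Fin d → ℝ) : ℝ :=
  ((n.choose m : ℝ))⁻¹ * ∑ c : Fin m → Fin n,
    if StrictMono c then W c * h (fun k => Y (c k)) else 0

/-- `max_{c ∈ C^n_m} |W c|`. -/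
def maxAbsWeight {m n : ℕ} (W : (Fin m → Fin n) → ℝ) : ℝ :=
  ⨆ c : Fin m → Fin n, if StrictMono c then |W c| else 0

/-- `h` is symmetric in its `m` arguments. -/
def SymmetricKernel {d m : ℕ} (h : (Fin m → Fin d → ℝ) → ℝ) : Prop :=
  ∀ (σ : Equiv.Perm (Fin m)) (x : Fin m → Fin d → ℝ), h (x ∘ σ) = h x

/-- Assumption H1: `h` is invariant under simultaneous orthogonal transformation of
its arguments. -/
def AssumptionH1 {d m : ℕ} (h : (Fin m → Fin d → ℝ) → ℝ) : Prop :=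
  ∀ Q : Matrix (Fin d) (Fin d) ℝ, Qᵀ * Q = 1 →
    ∀ x : Fin m → Fin d → ℝ, h (fun k => Q.mulVec (x k)) = h x

/-- Assumption H2 relative to a set `K₀ ⊆ ℝ^d`: viewing `h` as a function on `ℝ^{md}`,
`h` is twice continuously differentiable on an open neighborhood `S` of `K₀^m` on which its
Hessian is bounded in norm, and the Hessian is continuous on the closure of `K₀^m`. -/
def AssumptionH2On {d m : ℕ} (K₀ : Set (Fin d → ℝ)) (h : (Fin m → Fin d → ℝ) → ℝ) : Prop :=
  ∃ S : Set (Fin m → Fin d → ℝ), IsOpen S ∧ {x | ∀ k, x k ∈ K₀} ⊆ S ∧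
    ContDiffOn ℝ 2 h S ∧
    ContinuousOn (iteratedFDeriv ℝ 2 h) (closure {x | ∀ k, x k ∈ K₀}) ∧
    ∃ C : ℝ, ∀ x ∈ S, ‖iteratedFDeriv ℝ 2 h x‖ ≤ C

/-- Assumption H2 for an RDPG with latent position distribution `F`. -/
def AssumptionH2 {d m : ℕ} (F : Measure (Fin d → ℝ)) (h : (Fin m → Fin d → ℝ) → ℝ) : Prop :=
  AssumptionH2On (msupport F) h

/-- `θ(F) = E h(X₁, …, X_m)` for `X₁, …, X_m` i.i.d. `F`. -/
def thetaOf {d : ℕ} (m : ℕ) (F : Measure (Fin d → ℝ)) [SigmaFinite F]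
    (h : (Fin m → Fin d → ℝ) → ℝ) : ℝ :=
  ∫ x, h x ∂(Measure.pi fun _ : Fin m => F)

/-- The conditional expectation kernel `h₁(z) = E h(z, X₂, …, X_m)`. -/
def kern1 {d : ℕ} (m : ℕ) (hm : 0 < m) (F : Measure (Fin d → ℝ)) [SigmaFinite F]
    (h : (Fin m → Fin d → ℝ) → ℝ) (z : Fin d → ℝ) : ℝ :=
  ∫ x, h (Function.update x (⟨0, hm⟩ : Fin m) z) ∂(Measure.pi fun _ : Fin m => F)

/-- `ζ₁ = E (E[h(X₁,…,X_m) ∣ X₁] − θ)²`. -/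
def zeta1 {d : ℕ} (m : ℕ) (hm : 0 < m) (F : Measure (Fin d → ℝ)) [SigmaFinite F]
    (h : (Fin m → Fin d → ℝ) → ℝ) : ℝ :=
  ∫ z, (kern1 m hm F h z - thetaOf m F h) ^ 2 ∂F

/-- Weak convergence (convergence in distribution) of a sequence of real random variables
`T n` on `(Ω, P)` to the law `μ`, tested against bounded continuous functions. -/
def TendstoInDistribution {Ω : Type*} [MeasurableSpace Ω] (P : Measure Ω)
    (T : ℕ → Ω → ℝ) (μ : Measure ℝ) : Prop :=
  ∀ g : BoundedContinuousFunction ℝ ℝ,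
    Tendsto (fun n => ∫ ω, g (T n ω) ∂P) atTop (𝓝 (∫ x, g x ∂μ))

/-- The uniform distribution on `Fin n`. -/
def uniformFin (n : ℕ) : Measure (Fin n) := ((n : ℝ≥0))⁻¹ • Measure.count

/-- The empirical distribution of the points `Y 1, …, Y n`. -/
def empMeasure {d n : ℕ} (Y : Fin n → Fin d → ℝ) : Measure (Fin d → ℝ) :=
  ((n : ℝ≥0))⁻¹ • ∑ i : Fin n, Measure.dirac (Y i)

instance {d n : ℕ} (Y : Fin n → Fin d → ℝ) : IsFiniteMeasure (empMeasure Y) := by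
  unfold empMeasure; infer_instance

/-- The law of the bootstrapped network `Â*`: having observed `A ~ RDPG(F,n)` (in its
adjacency marginal), draw `Â* ~ RDPG(F̂_n, n)` where `F̂_n` is the empirical distribution
of the rows of the adjacency spectral embedding of `A`. -/
def bootLaw (d n : ℕ) (F : Measure (Fin d → ℝ)) [SigmaFinite F] :
    Measure (Fin n → Fin n → ℝ) :=
  (adjLaw d n F).bind fun a => adjLaw d n (empMeasure (ase d a))

/-- `ρ̂ = binom(n,2)⁻¹ Σ_{i<j} A_{ij}`, the empirical edge density. -/
def rhoHat {n : ℕ} (A : Fin n → Fin n → ℝ) : ℝ :=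
  ((n.choose 2 : ℝ))⁻¹ * ∑ i, ∑ j, if i < j then A i j else 0

/-- The (normalized) average degree. -/
def avgDegree {n : ℕ} (A : Fin n → Fin n → ℝ) : ℝ :=
  (n : ℝ)⁻¹ * ∑ i, (∑ j, if j ≠ i then A i j else 0) / ((n : ℝ) - 1)

/-- The subgraph-counting kernel `h_R` associated with a graph `R` on `m` vertices. -/
def subgraphKernel {m : ℕ} (d : ℕ) (R : SimpleGraph (Fin m)) (x : Fin m → Fin d → ℝ) : ℝ :=
  ((Nat.card {G : SimpleGraph (Fin m) // Nonempty (G ≃g R)} : ℝ))⁻¹ *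
    ∑ τ : Equiv.Perm (Fin m), ∏ p : Fin m × Fin m,
      if p.1 < p.2 then
        (if R.Adj p.1 p.2 then dotd (x (τ p.1)) (x (τ p.2))
          else 1 - dotd (x (τ p.1)) (x (τ p.2)))
      else 1

/-- The empirical subgraph density `P̂(R)` of `R` in the graph with adjacency matrix `A`:
the proportion of `m`-subsets of vertices whose induced subgraph is isomorphic to `R`. -/
def subgraphDensity {m n : ℕ} (R : SimpleGraph (Fin m)) (A : Fin n → Fin n → ℝ) : ℝ :=
  ((n.choose m : ℝ))⁻¹ * ∑ c : Fin m → Fin n,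
    if StrictMono c ∧ (∃ σ : Equiv.Perm (Fin m), ∀ k l : Fin m, k ≠ l →
        (A (c (σ k)) (c (σ l)) = 1 ↔ R.Adj k l)) then (1:ℝ) else 0

/-- The entrywise ℓ¹ norm of a matrix. -/
def matL1 {n : ℕ} (M : Fin n → Fin n → ℝ) : ℝ := ∑ i, ∑ j, |M i j|

/-- The graph matching distance between two `n`-vertex graphs. -/
def dGM {n : ℕ} (A B : Fin n → Fin n → ℝ) : ℝ :=
  ⨅ σ : Equiv.Perm (Fin n),
    ((n.choose 2 : ℝ))⁻¹ * (∑ i, ∑ j, |A i j - B (σ i) (σ j)|) / 2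

/-- The set of couplings of two measures. -/
def Couplings {α β : Type*} [MeasurableSpace α] [MeasurableSpace β]
    (μ : Measure α) (ν : Measure β) : Set (Measure (α × β)) :=
  {γ | IsProbabilityMeasure γ ∧ γ.map Prod.fst = μ ∧ γ.map Prod.snd = ν}

/-- `W_{GM,p}^p`: the `p`-th power of the graph-matching Wasserstein distance between two
laws of random adjacency matrices. -/
def WGMpow {n : ℕ} (p : ℝ) (μ ν : Measure (Fin n → Fin n → ℝ)) : ℝ :=
  sInf ((fun γ => ∫ q, dGM q.1 q.2 ^ p ∂γ) '' Couplings μ ν)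

/-- The Wasserstein `p`-distance between two distributions on `ℝ^d` (with Euclidean cost). -/
def wassersteinP {d : ℕ} (p : ℝ) (μ ν : Measure (Fin d → ℝ)) : ℝ :=
  sInf ((fun γ => (∫ q, euclNorm (q.1 - q.2) ^ p ∂γ) ^ (1/p)) '' Couplings μ ν)

/-- `d̊_p(F₁,F₂) = min_{Q ∈ O(d)} d_p(F₁, F₂ ∘ Q)`. -/
def ringWasserstein {d : ℕ} (p : ℝ) (μ ν : Measure (Fin d → ℝ)) : ℝ :=
  sInf {r | ∃ Q : Matrix (Fin d) (Fin d) ℝ, Qᵀ * Q = 1 ∧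
    r = wassersteinP p μ (ν.map fun x => Q.mulVec x)}

/-- The Frobenius norm of a matrix. -/
def frobNorm {n d : ℕ} (M : Matrix (Fin n) (Fin d) ℝ) : ℝ :=
  Real.sqrt (∑ i, ∑ j, (M i j) ^ 2)

/-- The `2→∞` norm of a matrix: the maximum Euclidean norm of a row. -/
def twoInftyNorm {n d : ℕ} (M : Matrix (Fin n) (Fin d) ℝ) : ℝ := ⨆ i, euclNorm (M i)

/-- `U`, `lam` form a rank-`d` spectral decomposition of the symmetric matrix `Pm`:
the columns of `U` are orthonormal eigenvectors with eigenvalues `lam`, and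
`Pm = U · diag(lam) · Uᵀ`. -/
def IsSpecDecomp {n d : ℕ} (Pm : Fin n → Fin n → ℝ) (U : Fin n → Fin d → ℝ)
    (lam : Fin d → ℝ) : Prop :=
  (∀ j j', (∑ i, U i j * U i j') = if j = j' then (1:ℝ) else 0) ∧
  (∀ j, (Matrix.of Pm).mulVec (fun i => U i j) = fun i => lam j * U i j) ∧
  (∀ i i', Pm i i' = ∑ j, U i j * lam j * U i' j)

/-- `U`, `lam` are orthonormal eigenvectors of `A` for its `d` largest-in-magnitude
eigenvalues. -/
def IsTopSpec {n d : ℕ} (A : Fin n → Fin n → ℝ) (U : Fin n → Fin d → ℝ)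
    (lam : Fin d → ℝ) : Prop :=
  (∀ j j', (∑ i, U i j * U i j') = if j = j' then (1:ℝ) else 0) ∧
  (∀ j, (Matrix.of A).mulVec (fun i => U i j) = fun i => lam j * U i j) ∧
  (∀ (mu : ℝ) (v : Fin n → ℝ), v ≠ 0 → (Matrix.of A).mulVec v = mu • v →
    (∀ j, (∑ i, v i * U i j) = 0) → ∀ j, |mu| ≤ |lam j|)

/-- The `2→∞` bound with constant `C`: `max_i ‖Qᵀ Xh_i − X_i‖ ≤ C log n / √n`. -/
def TwoToInftyBound {n d : ℕ} (C : ℝ) (Xh X : Fin n → Fin d → ℝ)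
    (Q : Matrix (Fin d) (Fin d) ℝ) : Prop :=
  ∀ i, euclNorm (Qᵀ.mulVec (Xh i) - X i) ≤ C * Real.log n / Real.sqrt n

/-- The second moment matrix `Δ = E X₁ X₁ᵀ` of a distribution `F` on `ℝ^d`. -/
def secondMoment {d : ℕ} (F : Measure (Fin d → ℝ)) : Matrix (Fin d) (Fin d) ℝ :=
  Matrix.of fun i j => ∫ x, x i * x j ∂F


/-- Spectral theorem for real symmetric matrices in coordinates. -/
lemma exists_eigenbasis {n : ℕ} (H : Matrix (Fin n) (Fin n) ℝ) (hH : Hᵀ = H) :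
    ∃ (B : Matrix (Fin n) (Fin n) ℝ) (l : Fin n → ℝ),
      B * Bᵀ = 1 ∧ Bᵀ * B = 1 ∧ H = Bᵀ * Matrix.diagonal l * B ∧
      H.rank = Fintype.card {i // l i ≠ 0} := by
  have hh : H.IsHermitian := by
    rw [Matrix.IsHermitian, Matrix.conjTranspose_eq_transpose_of_trivial, hH]
  let V : Matrix (Fin n) (Fin n) ℝ := hh.eigenvectorUnitary
  have h1 : star V * V = 1 := by simp [V]
  have h2 : V * star V = 1 := by simp [V]
  have hs : star V = Vᵀ := by
    rw [Matrix.star_eq_conjTranspose, Matrix.conjTranspose_eq_transpose_of_trivial]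
  refine ⟨Vᵀ, hh.eigenvalues, ?_, ?_, ?_, ?_⟩
  · rw [← hs, ← h1, hs, Matrix.transpose_transpose]
  · rw [← h2, hs, Matrix.transpose_transpose]
  · have := hh.spectral_theorem
    rw [Unitary.conjStarAlgAut_apply] at this
    rw [Matrix.transpose_transpose, ← hs]
    exact this
  · convert hh.rank_eq_card_non_zero_eigs

/-- Eigenvectors of the coordinate spectral theorem. -/
lemma eigenbasis_mulVec {n : ℕ} {H B : Matrix (Fin n) (Fin n) ℝ} {l : Fin n → ℝ}
    (h1 : B * Bᵀ = 1) (h : H = Bᵀ * Matrix.diagonal l * B) (k : Fin n) :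
    H *ᵥ (B k) = l k • B k := by
  have h2 : H * Bᵀ = Bᵀ * Matrix.diagonal l := by
    rw [h, Matrix.mul_assoc, h1, Matrix.mul_one]
  ext i
  have := congrFun (congrFun h2 i) k
  rw [Matrix.mul_diagonal] at this
  simp only [Matrix.mul_apply, Matrix.transpose_apply] at this
  simp only [Matrix.mulVec, dotProduct, Pi.smul_apply, smul_eq_mul]
  rw [this, mul_comm]

/-- Quadratic form bound from an eigenvalue bound. -/
lemma opnorm_of_eig {n : ℕ} (H : Matrix (Fin n) (Fin n) ℝ) (hH : Hᵀ = H) (c : ℝ)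
    (hc : ∀ (μ : ℝ) (w : Fin n → ℝ), w ≠ 0 → H *ᵥ w = μ • w → |μ| ≤ c) (z : Fin n → ℝ) :
    |z ⬝ᵥ H *ᵥ z| ≤ c * (z ⬝ᵥ z) := by
  obtain ⟨B, l, h1, h2, h3, -⟩ := exists_eigenbasis H hH
  have hl : ∀ k, |l k| ≤ c := by
    intro k
    refine hc (l k) (B k) ?_ (eigenbasis_mulVec h1 h3 k)
    intro h0
    have := congrFun (congrFun h1 k) k
    simp [Matrix.mul_apply, h0] at this
  have e1 : z ⬝ᵥ H *ᵥ z = ∑ k, l k * ((B *ᵥ z) k)^2 := by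
    rw [h3, ← Matrix.mulVec_mulVec, ← Matrix.mulVec_mulVec, Matrix.dotProduct_mulVec,
      Matrix.vecMul_transpose]
    simp only [dotProduct, Matrix.mulVec_diagonal]
    refine Finset.sum_congr rfl fun k _ => by ring
  have e2 : z ⬝ᵥ z = ∑ k, ((B *ᵥ z) k)^2 := by
    have : (B *ᵥ z) ⬝ᵥ (B *ᵥ z) = z ⬝ᵥ z := by
      rw [Matrix.dotProduct_mulVec, Matrix.vecMul_mulVec, h2]; simp
    rw [← this]; simp [dotProduct, sq]
  rw [e1, e2, Finset.mul_sum]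
  refine (Finset.abs_sum_le_sum_abs _ _).trans (Finset.sum_le_sum fun k _ => ?_)
  rw [abs_mul, abs_of_nonneg (sq_nonneg ((B *ᵥ z) k))]
  exact mul_le_mul_of_nonneg_right (hl k) (sq_nonneg _)

/-- Frobenius norm bound by rank and quadratic form bound. -/
lemma frob_of_rank {n : ℕ} (H : Matrix (Fin n) (Fin n) ℝ) (hH : Hᵀ = H) (c : ℝ) (r : ℕ)
    (hr : H.rank ≤ r) (hc : ∀ z : Fin n → ℝ, |z ⬝ᵥ H *ᵥ z| ≤ c * (z ⬝ᵥ z)) :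
    ∑ i, ∑ j, (H i j)^2 ≤ r * c^2 := by
  obtain ⟨B, l, h1, h2, h3, h4⟩ := exists_eigenbasis H hH
  have hl : ∀ k, |l k| ≤ c := by
    intro k
    have := hc (B k)
    rw [eigenbasis_mulVec h1 h3 k] at this
    have h5 : B k ⬝ᵥ B k = 1 := by
      have := congrFun (congrFun h1 k) k
      simpa [Matrix.mul_apply, dotProduct] using this
    simpa [h5] using this
  have e1 : ∑ i, ∑ j, (H i j)^2 = (H * H).trace := by
    simp only [Matrix.trace, Matrix.diag, Matrix.mul_apply]
    refine Finset.sum_congr rfl fun i _ => Finset.sum_congr rfl fun j _ => ?_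
    rw [sq]; congr 1; exact congrFun (congrFun hH j) i
  have e2 : (H * H).trace = ∑ k, (l k)^2 := by
    have : H * H = Bᵀ * (Matrix.diagonal l * Matrix.diagonal l * B) := by
      rw [h3]
      calc _ = Bᵀ * Matrix.diagonal l * (B * Bᵀ) * Matrix.diagonal l * B := by
            simp only [Matrix.mul_assoc]
        _ = _ := by rw [h1]; simp only [Matrix.mul_assoc, Matrix.one_mul]
    rw [this, Matrix.trace_mul_comm, Matrix.mul_assoc, h1, Matrix.mul_one,
      Matrix.diagonal_mul_diagonal, Matrix.trace_diagonal]
    simp [sq]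
  rw [e1, e2]
  have e3 : ∑ k, (l k)^2 = ∑ k ∈ Finset.univ.filter (fun k => l k ≠ 0), (l k)^2 := by
    rw [Finset.sum_filter]
    refine Finset.sum_congr rfl fun k _ => ?_
    by_cases h : l k = 0 <;> simp [h]
  rw [e3]
  refine (Finset.sum_le_card_nsmul _ _ (c^2) fun k _ => ?_).trans ?_
  · rw [← sq_abs]; exact pow_le_pow_left₀ (abs_nonneg _) (hl k) 2
  · rw [nsmul_eq_mul]
    refine mul_le_mul_of_nonneg_right ?_ (sq_nonneg _)
    have : (Finset.univ.filter (fun k => l k ≠ 0)).card ≤ r := by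
      rw [← Fintype.card_subtype]; rw [h4] at hr; convert hr
    exact_mod_cast this

/-- Weyl-type inequality: eigenvalues of `A = X Xᵀ + E` beyond the top `d` are small. -/
lemma weyl_aux {n d : ℕ} (A : Matrix (Fin n) (Fin n) ℝ)
    (X U : Matrix (Fin n) (Fin d) ℝ) (lam : Fin d → ℝ) (ε : ℝ) (hε : 0 ≤ ε)
    (hE : ∀ z : Fin n → ℝ, ((A - X * Xᵀ) *ᵥ z) ⬝ᵥ ((A - X * Xᵀ) *ᵥ z) ≤ ε^2 * (z ⬝ᵥ z))
    (hU : Uᵀ * U = 1) (hAU : A * U = U * Matrix.diagonal lam)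
    (mu : ℝ) (v : Fin n → ℝ) (hv : v ≠ 0) (hAv : A *ᵥ v = mu • v) (hvU : Uᵀ *ᵥ v = 0)
    (hlam : ∀ j, |mu| ≤ |lam j|) : |mu| ≤ ε := by
  -- choose a combination killed by `Xᵀ`
  let f : ((Fin d → ℝ) × ℝ) →ₗ[ℝ] (Fin d → ℝ) :=
    LinearMap.coprod (Matrix.mulVecLin (Xᵀ * U)) (LinearMap.toSpanSingleton ℝ _ (Xᵀ *ᵥ v))
  have hker : LinearMap.ker f ≠ ⊥ := by
    apply LinearMap.ker_ne_bot_of_finrank_lt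
    simp
  obtain ⟨⟨c, s⟩, hmem, hne⟩ := Submodule.exists_mem_ne_zero_of_ne_bot hker
  have hf : (Xᵀ * U) *ᵥ c + s • (Xᵀ *ᵥ v) = 0 := hmem
  set w : Fin n → ℝ := U *ᵥ c + s • v with hw
  have hXw : Xᵀ *ᵥ w = 0 := by
    rw [hw, Matrix.mulVec_add, Matrix.mulVec_smul, Matrix.mulVec_mulVec]; exact hf
  have hAw : A *ᵥ w = U *ᵥ (Matrix.diagonal lam *ᵥ c) + (s * mu) • v := by
    rw [hw, Matrix.mulVec_add, Matrix.mulVec_smul, Matrix.mulVec_mulVec, hAU, hAv,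
      ← Matrix.mulVec_mulVec, smul_smul]
  have key : ∀ (a : Fin d → ℝ) (t : ℝ),
      (U *ᵥ a + t • v) ⬝ᵥ (U *ᵥ a + t • v) = a ⬝ᵥ a + t^2 * (v ⬝ᵥ v) := by
    intro a t
    have h1 : (U *ᵥ a) ⬝ᵥ (U *ᵥ a) = a ⬝ᵥ a := by
      rw [Matrix.dotProduct_mulVec, Matrix.vecMul_mulVec, hU]; simp
    have h2 : v ⬝ᵥ (U *ᵥ a) = 0 := by
      rw [Matrix.dotProduct_mulVec, ← Matrix.mulVec_transpose, hvU]; simp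
    have h3 : (U *ᵥ a) ⬝ᵥ v = 0 := by rw [dotProduct_comm, h2]
    simp only [add_dotProduct, dotProduct_add, smul_dotProduct, dotProduct_smul, smul_eq_mul,
      h1, h2, h3]
    ring
  have hvv : 0 < v ⬝ᵥ v := by
    have h0 : 0 ≤ v ⬝ᵥ v := Finset.sum_nonneg fun i _ => mul_self_nonneg _
    refine lt_of_le_of_ne h0 fun h => hv (dotProduct_self_eq_zero.mp h.symm)
  have hww : 0 < w ⬝ᵥ w := by
    rw [hw, key]
    have h0 : 0 ≤ c ⬝ᵥ c := Finset.sum_nonneg fun i _ => mul_self_nonneg _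
    by_cases hs : s = 0
    · have hc : c ≠ 0 := by
        rintro rfl; apply hne; simp [hs]
      have : 0 < c ⬝ᵥ c :=
        lt_of_le_of_ne h0 fun h => hc (dotProduct_self_eq_zero.mp h.symm)
      positivity
    · positivity
  have hEw : (A - X * Xᵀ) *ᵥ w = A *ᵥ w := by
    rw [Matrix.sub_mulVec, ← Matrix.mulVec_mulVec, hXw]; simp
  have h1 := hE w
  rw [hEw, hAw, key] at h1
  have h2 : mu^2 * (c ⬝ᵥ c) ≤ (Matrix.diagonal lam *ᵥ c) ⬝ᵥ (Matrix.diagonal lam *ᵥ c) := by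
    simp only [dotProduct, Matrix.mulVec_diagonal, Finset.mul_sum]
    refine Finset.sum_le_sum fun j _ => ?_
    have : mu^2 ≤ (lam j)^2 := sq_le_sq.mpr (hlam j)
    nlinarith [mul_self_nonneg (c j)]
  have h3 : mu^2 * (w ⬝ᵥ w) ≤ ε^2 * (w ⬝ᵥ w) := by
    calc mu^2 * (w ⬝ᵥ w) = mu^2 * (c ⬝ᵥ c) + (s*mu)^2 * (v ⬝ᵥ v) := by rw [hw, key]; ring
      _ ≤ _ := by linarith
  have h4 : mu^2 ≤ ε^2 := le_of_mul_le_mul_right h3 hww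
  exact abs_le_of_sq_le_sq h4 hε

lemma ase_frob {n d : ℕ} (A : Fin n → Fin n → ℝ) (hA : (Matrix.of A)ᵀ = Matrix.of A)
    (X Xh : Fin n → Fin d → ℝ) (hX : IsASE A Xh) (ε : ℝ) (hε : 0 ≤ ε)
    (hE : ∀ z : Fin n → ℝ, ((Matrix.of A - Matrix.of X * (Matrix.of X)ᵀ) *ᵥ z) ⬝ᵥ
      ((Matrix.of A - Matrix.of X * (Matrix.of X)ᵀ) *ᵥ z) ≤ ε^2 * (z ⬝ᵥ z)) :
    ∑ i, ∑ j, (dotd (X i) (X j) - dotd (Xh i) (Xh j))^2 ≤ (2 * d : ℕ) * (3 * ε)^2 := by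
  obtain ⟨lam, U', hU1, hU2, hU3, hU4⟩ := hX
  set U : Matrix (Fin n) (Fin d) ℝ := Matrix.of U' with hUdef
  set M : Matrix (Fin n) (Fin n) ℝ := Matrix.of A with hM
  set Y : Matrix (Fin n) (Fin d) ℝ := Matrix.of X with hY
  set Yh : Matrix (Fin n) (Fin d) ℝ := Matrix.of Xh with hYh
  have hU : Uᵀ * U = 1 := by
    ext j j'
    rw [Matrix.mul_apply, Matrix.one_apply]
    simpa [hUdef] using hU1 j j'
  have hAU : M * U = U * Matrix.diagonal lam := by
    ext i j
    have := congrFun (hU2 j) i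
    rw [Matrix.mul_diagonal, Matrix.mul_apply]
    simp only [Matrix.mulVec, dotProduct] at this
    rw [mul_comm]
    simpa [hUdef] using this
  have hYY : Yh * Yhᵀ = U * Matrix.diagonal (fun j => |lam j|) * Uᵀ := by
    ext i i'
    rw [Matrix.mul_apply, Matrix.mul_apply]
    refine Finset.sum_congr rfl fun j _ => ?_
    rw [Matrix.mul_diagonal]
    simp only [hYh, Matrix.transpose_apply, Matrix.of_apply, hU4, hUdef]
    have := Real.mul_self_sqrt (abs_nonneg (lam j))
    calc _ = U' i j * (√|lam j| * √|lam j|) * U' i' j := by ring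
      _ = _ := by rw [this]
  have hsymE : (M - Y * Yᵀ)ᵀ = M - Y * Yᵀ := by
    rw [Matrix.transpose_sub, hA, Matrix.transpose_mul, Matrix.transpose_transpose]
  -- quadratic form of E
  have hq : ∀ z : Fin n → ℝ, |z ⬝ᵥ (M - Y * Yᵀ) *ᵥ z| ≤ ε * (z ⬝ᵥ z) := by
    apply opnorm_of_eig _ hsymE
    intro μ w hw hμ
    have h1 := hE w
    rw [hμ] at h1
    have hww : 0 < w ⬝ᵥ w := by
      have h0 : 0 ≤ w ⬝ᵥ w := Finset.sum_nonneg fun i _ => mul_self_nonneg _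
      exact lt_of_le_of_ne h0 fun h => hw (dotProduct_self_eq_zero.mp h.symm)
    simp only [smul_dotProduct, dotProduct_smul, smul_eq_mul] at h1
    have h4 : μ^2 ≤ ε^2 := le_of_mul_le_mul_right (by linarith [h1]) hww
    exact abs_le_of_sq_le_sq h4 hε
  have hneg : ∀ j, -ε ≤ lam j := by
    intro j
    have hcol : M *ᵥ (fun i => U i j) = lam j • (fun i => U i j) := by
      have := hU2 j
      ext i
      simpa [hUdef] using congrFun this i
    have h1 := hq (fun i => U i j)
    have hu : (fun i => U i j) ⬝ᵥ (fun i => U i j) = 1 := by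
      have := hU1 j j; simpa [dotProduct, hUdef] using this
    rw [Matrix.sub_mulVec, dotProduct_sub, hcol, dotProduct_smul, hu, ← Matrix.mulVec_mulVec,
      Matrix.dotProduct_mulVec, ← Matrix.mulVec_transpose] at h1
    have h0 : 0 ≤ (Yᵀ *ᵥ fun i => U i j) ⬝ᵥ (Yᵀ *ᵥ fun i => U i j) :=
      Finset.sum_nonneg fun i _ => mul_self_nonneg _
    have := (abs_le.mp h1).1
    simp only [smul_eq_mul, mul_one] at this
    linarith
  have hsymH : (M - Yh * Yhᵀ)ᵀ = M - Yh * Yhᵀ := by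
    rw [Matrix.transpose_sub, hA, Matrix.transpose_mul, Matrix.transpose_transpose]
  have hH : ∀ z : Fin n → ℝ, |z ⬝ᵥ (M - Yh * Yhᵀ) *ᵥ z| ≤ (2*ε) * (z ⬝ᵥ z) := by
    apply opnorm_of_eig _ hsymH
    intro μ w hw hμ
    by_cases hUw : Uᵀ *ᵥ w = 0
    · have h1 : M *ᵥ w = μ • w := by
        rw [Matrix.sub_mulVec, hYY, ← Matrix.mulVec_mulVec, hUw] at hμ
        simpa using hμ
      have := weyl_aux M Y U lam ε hε hE hU hAU μ w hw h1 hUw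
        (hU3 μ w hw h1 (fun j => by
          have := congrFun hUw j
          simp only [Matrix.mulVec, dotProduct, Matrix.transpose_apply, Pi.zero_apply] at this
          rw [← this]
          exact Finset.sum_congr rfl fun i _ => by simp [hUdef, mul_comm]))
      linarith
    · -- w has a component along some column
      obtain ⟨j, hj⟩ : ∃ j, (Uᵀ *ᵥ w) j ≠ 0 := by
        by_contra hcon
        push Not at hcon
        exact hUw (funext hcon)
      have h1 : (M - Yh * Yhᵀ) * U = U * Matrix.diagonal (fun j => lam j - |lam j|) := by
        rw [Matrix.sub_mul, hAU, hYY, Matrix.mul_assoc, hU, Matrix.mul_one, ← Matrix.mul_sub,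
          Matrix.diagonal_sub]
      have h2 : Uᵀ *ᵥ ((M - Yh * Yhᵀ) *ᵥ w)
          = Matrix.diagonal (fun j => lam j - |lam j|) *ᵥ (Uᵀ *ᵥ w) := by
        rw [Matrix.mulVec_mulVec, Matrix.mulVec_mulVec]
        congr 1
        have := congrArg Matrix.transpose h1
        rw [Matrix.transpose_mul, hsymH, Matrix.transpose_mul, Matrix.diagonal_transpose] at this
        exact this
      rw [hμ, Matrix.mulVec_smul] at h2
      have h3 := congrFun h2 j
      rw [Matrix.mulVec_diagonal, Pi.smul_apply, smul_eq_mul] at h3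
      have h4 : μ = lam j - |lam j| := mul_right_cancel₀ hj h3
      rw [h4]
      have := hneg j
      rcases le_total 0 (lam j) with h | h
      · rw [abs_of_nonneg h]; simp; exact hε
      · rw [abs_of_nonpos h, abs_le]; constructor <;> linarith
  have hD : ∀ z : Fin n → ℝ, |z ⬝ᵥ (Y * Yᵀ - Yh * Yhᵀ) *ᵥ z| ≤ (3*ε) * (z ⬝ᵥ z) := by
    intro z
    have e : Y * Yᵀ - Yh * Yhᵀ = (M - Yh * Yhᵀ) - (M - Y * Yᵀ) := by abel
    rw [e, Matrix.sub_mulVec, dotProduct_sub]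
    refine (abs_sub _ _).trans ?_
    linarith [hq z, hH z]
  have hrank : (Y * Yᵀ - Yh * Yhᵀ).rank ≤ 2 * d := by
    have e : Y * Yᵀ - Yh * Yhᵀ = Y * Yᵀ + (-Yh) * Yhᵀ := by
      rw [Matrix.neg_mul, sub_eq_add_neg]
    rw [e, ← Matrix.fromCols_mul_fromRows]
    refine (Matrix.rank_mul_le_left _ _).trans ((Matrix.rank_le_card_width _).trans ?_)
    simp; omega
  have hsym : (Y * Yᵀ - Yh * Yhᵀ)ᵀ = Y * Yᵀ - Yh * Yhᵀ := by
    simp [Matrix.transpose_sub, Matrix.transpose_mul]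
  have := frob_of_rank _ hsym (3*ε) (2*d) hrank hD
  simpa [Matrix.sub_apply, Matrix.mul_apply, dotd, hY, hYh] using this

lemma exists_isASE {n d : ℕ} (hd : d ≤ n) (A : Fin n → Fin n → ℝ)
    (hA : (Matrix.of A)ᵀ = Matrix.of A) : ∃ Xh : Fin n → Fin d → ℝ, IsASE A Xh := by
  obtain ⟨B, l, h1, h2, h3, -⟩ := exists_eigenbasis (Matrix.of A) hA
  let σ := Tuple.sort (fun k => -|l k|)
  have hmono : Monotone ((fun k => -|l k|) ∘ σ) := Tuple.monotone_sort _
  refine ⟨_, fun j => l (σ (Fin.castLE hd j)), fun i j => B (σ (Fin.castLE hd j)) i,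
    ?_, ?_, ?_, fun i j => rfl⟩
  · intro j j'
    have := congrFun (congrFun h1 (σ (Fin.castLE hd j))) (σ (Fin.castLE hd j'))
    rw [Matrix.mul_apply, Matrix.one_apply] at this
    simp only [Matrix.transpose_apply, EmbeddingLike.apply_eq_iff_eq, Fin.castLE_inj] at this
    rw [this]
  · intro j
    have := eigenbasis_mulVec h1 h3 (σ (Fin.castLE hd j))
    exact this
  · intro mu v hv hmu hperp j
    have hBv : B *ᵥ v ≠ 0 := by
      intro h0
      apply hv
      have : Bᵀ *ᵥ (B *ᵥ v) = v := by rw [Matrix.mulVec_mulVec, h2, Matrix.one_mulVec]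
      rw [← this, h0, Matrix.mulVec_zero]
    obtain ⟨k, hk⟩ : ∃ k, (B *ᵥ v) k ≠ 0 := by
      by_contra hcon
      push Not at hcon
      exact hBv (funext hcon)
    have e : mu • (B *ᵥ v) = Matrix.diagonal l *ᵥ (B *ᵥ v) := by
      rw [← Matrix.mulVec_smul, ← hmu, h3, ← Matrix.mulVec_mulVec, ← Matrix.mulVec_mulVec,
        Matrix.mulVec_mulVec _ B, h1, Matrix.one_mulVec]
    have hml : mu = l k := by
      have := congrFun e k
      rw [Matrix.mulVec_diagonal, Pi.smul_apply, smul_eq_mul] at this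
      exact mul_right_cancel₀ hk this
    obtain ⟨m, rfl⟩ := σ.surjective k
    have hm : d ≤ m.val := by
      by_contra hlt
      push Not at hlt
      apply hk
      have := hperp ⟨m.val, hlt⟩
      simp only [Fin.castLE_mk, Fin.eta] at this
      rw [← this]
      simp only [Matrix.mulVec, dotProduct]
      exact Finset.sum_congr rfl fun i _ => mul_comm _ _
    have := hmono (show Fin.castLE hd j ≤ m by
      rw [Fin.le_def, Fin.val_castLE]; exact (j.isLt.le.trans hm))
    simp only [Function.comp] at this
    rw [hml]; linarith

lemma ase_isASE {n d : ℕ} (hd : d ≤ n) (A : Fin n → Fin n → ℝ)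
    (hA : (Matrix.of A)ᵀ = Matrix.of A) : IsASE A (ase d A) := by
  have h := exists_isASE (d := d) hd A hA
  rw [ase, dif_pos h]
  exact h.choose_spec

/-- The deterministic `ℓ¹` bound. -/
lemma ase_l1 {n d : ℕ} (hd : d ≤ n) (A : Fin n → Fin n → ℝ) (hA : (Matrix.of A)ᵀ = Matrix.of A)
    (X : Fin n → Fin d → ℝ) (ε : ℝ) (hε : 0 ≤ ε)
    (hE : ∀ z : Fin n → ℝ, ((Matrix.of A - Matrix.of X * (Matrix.of X)ᵀ) *ᵥ z) ⬝ᵥ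
      ((Matrix.of A - Matrix.of X * (Matrix.of X)ᵀ) *ᵥ z) ≤ ε^2 * (z ⬝ᵥ z)) :
    ∑ i, ∑ j, |dotd (X i) (X j) - dotd (ase d A i) (ase d A j)|
      ≤ n * (√(2 * d) * (3 * ε)) := by
  have h := ase_frob A hA X _ (ase_isASE hd A hA) ε hε hE
  rw [← Finset.sum_product'] at h ⊢
  have h2 := sq_sum_le_card_mul_sum_sq (s := (Finset.univ : Finset (Fin n)) ×ˢ Finset.univ)
    (f := fun q => |dotd (X q.1) (X q.2) - dotd (ase d A q.1) (ase d A q.2)|)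
  simp only [sq_abs] at h2
  apply le_of_sq_le_sq _ (by positivity)
  refine h2.trans ?_
  have e : ((n : ℝ) * (√(2 * d) * (3 * ε)))^2 = (n*n) * ((2*d : ℕ) * (3*ε)^2) := by
    rw [mul_pow, mul_pow, Real.sq_sqrt (by positivity)]; push_cast; ring
  rw [e]
  simp only [Finset.card_product, Finset.card_univ, Fintype.card_fin, Nat.cast_mul]
  push_cast at h ⊢
  gcongr

/-- A net of the ball of radius `2`. -/
lemma exists_net (n : ℕ) : ∃ N : Finset (EuclideanSpace ℝ (Fin n)), N.card ≤ 5^n ∧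
    (∀ x ∈ N, ‖x‖ ≤ 2) ∧ ∀ z : EuclideanSpace ℝ (Fin n), ‖z‖ ≤ 2 → ∃ x ∈ N, ‖z - x‖ ≤ 1 := by
  let good : Finset (EuclideanSpace ℝ (Fin n)) → Prop := fun s =>
    (∀ c ∈ s, ‖c‖ ≤ 2) ∧ ∀ c ∈ s, ∀ e ∈ s, c ≠ e → 1 ≤ ‖c - e‖
  have hb : ∀ s, good s → s.card ≤ 5^n := fun s hs => by
    simpa using Besicovitch.card_le_of_separated s hs.1 hs.2
  obtain ⟨m, ⟨N, hN, hNm⟩, hmax⟩ : ∃ m, (∃ s, good s ∧ s.card = m) ∧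
      ∀ s, good s → s.card ≤ m := by
    have hex : ∃ m, ∃ s, good s ∧ s.card = m := ⟨0, ∅, by simp [good], by simp⟩
    have hbd : ∀ m, (∃ s, good s ∧ s.card = m) → m ≤ 5^n := by
      rintro m ⟨s, hs, rfl⟩; exact hb s hs
    refine ⟨Nat.findGreatest (fun m => ∃ s, good s ∧ s.card = m) (5^n), ?_, ?_⟩
    · obtain ⟨m, hm⟩ := hex
      exact Nat.findGreatest_spec (P := fun m => ∃ s, good s ∧ s.card = m) (hbd m hm) hm
    · intro s hs
      exact Nat.le_findGreatest (hb s hs) ⟨s, hs, rfl⟩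
  refine ⟨N, hb N hN, hN.1, fun z hz => ?_⟩
  by_contra hcon
  push Not at hcon
  have hz' : z ∉ N := fun h => by have := hcon z h; simp at this; linarith
  have hg : good (insert z N) := by
    refine ⟨?_, ?_⟩
    · intro c hc
      rcases Finset.mem_insert.mp hc with rfl | hc
      · exact hz
      · exact hN.1 c hc
    · intro c hc e he hce
      rcases Finset.mem_insert.mp hc with hc1 | hc1 <;>
        rcases Finset.mem_insert.mp he with he1 | he1
      · exact absurd (hc1.trans he1.symm) hce
      · rw [hc1]; exact (hcon e he1).le
      · rw [he1, norm_sub_rev]; exact (hcon c hc1).le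
      · exact hN.2 c hc1 e he1 hce
  have := hmax _ hg
  rw [Finset.card_insert_of_notMem hz', hNm] at this
  omega

/-- Operator norm from a net. -/
lemma opnorm_of_net {E : Type*} [NormedAddCommGroup E] [InnerProductSpace ℝ E]
    (N : Finset E) (hN : ∀ z : E, ‖z‖ ≤ 2 → ∃ x ∈ N, ‖z - x‖ ≤ 1) (T : E →L[ℝ] E) (t : ℝ)
    (ht : 0 ≤ t) (h : ∀ x ∈ N, ∀ y ∈ N, inner ℝ x (T y) ≤ t) : ‖T‖ ≤ t := by
  have h1 : ∀ w : E, (∀ x ∈ N, inner ℝ x w ≤ t) → ‖w‖ ≤ t := by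
    intro w hw
    by_cases hw0 : w = 0
    · simp [hw0, ht]
    have hp : 0 < ‖w‖ := norm_pos_iff.mpr hw0
    obtain ⟨x, hx, hxd⟩ := hN ((2 * ‖w‖⁻¹) • w) (by
      rw [norm_smul]; simp [hp.ne'])
    have e : inner ℝ ((2 * ‖w‖⁻¹) • w) w = 2 * ‖w‖ := by
      rw [real_inner_smul_left, real_inner_self_eq_norm_sq]; field_simp
    have e2 : inner ℝ ((2 * ‖w‖⁻¹) • w - x) w ≤ ‖w‖ := by
      refine (real_inner_le_norm _ _).trans ?_
      nlinarith
    rw [inner_sub_left, e] at e2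
    linarith [hw x hx]
  have h2 : ‖T‖ ≤ (t + ‖T‖) / 2 := by
    refine T.opNorm_le_bound (by positivity) fun z => ?_
    by_cases hz0 : z = 0
    · simp [hz0]
    have hp : 0 < ‖z‖ := norm_pos_iff.mpr hz0
    obtain ⟨x, hx, hxd⟩ := hN ((2 * ‖z‖⁻¹) • z) (by
      rw [norm_smul]; simp [hp.ne'])
    have e1 : ‖T x‖ ≤ t := h1 _ fun y hy => h y hy x hx
    have e2 : ‖T ((2 * ‖z‖⁻¹) • z - x)‖ ≤ ‖T‖ := by
      refine (T.le_opNorm _).trans ?_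
      nlinarith [norm_nonneg T]
    have e3 : ‖T ((2 * ‖z‖⁻¹) • z)‖ ≤ t + ‖T‖ := by
      have : T ((2 * ‖z‖⁻¹) • z) = T x + T ((2 * ‖z‖⁻¹) • z - x) := by rw [map_sub]; abel
      rw [this]
      exact (norm_add_le _ _).trans (add_le_add e1 e2)
    rw [map_smul, norm_smul, Real.norm_of_nonneg (by positivity)] at e3
    have : ‖T z‖ = (2 * ‖z‖⁻¹ * ‖T z‖) * ‖z‖ / 2 := by field_simp
    rw [this]
    nlinarith
  linarith

lemma mulVec_of_net {n : ℕ} (N : Finset (EuclideanSpace ℝ (Fin n)))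
    (hN : ∀ z : EuclideanSpace ℝ (Fin n), ‖z‖ ≤ 2 → ∃ x ∈ N, ‖z - x‖ ≤ 1)
    (M : Matrix (Fin n) (Fin n) ℝ) (t : ℝ) (ht : 0 ≤ t)
    (h : ∀ x ∈ N, ∀ y ∈ N, x.ofLp ⬝ᵥ M *ᵥ y.ofLp ≤ t) (z : Fin n → ℝ) :
    (M *ᵥ z) ⬝ᵥ (M *ᵥ z) ≤ t^2 * (z ⬝ᵥ z) := by
  let T := Matrix.toEuclideanCLM (𝕜 := ℝ) M
  have hT : ∀ y : EuclideanSpace ℝ (Fin n), (T y).ofLp = M *ᵥ y.ofLp := fun y => by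
    simp [T]
  have hn := opnorm_of_net N hN T t ht (fun x hx y hy => by
    refine le_trans (le_of_eq ?_) (h x hx y hy)
    rw [← hT, EuclideanSpace.inner_eq_star_dotProduct, dotProduct_comm]
    simp)
  have hsq : ∀ y : EuclideanSpace ℝ (Fin n), ‖y‖^2 = y.ofLp ⬝ᵥ y.ofLp := fun y => by
    rw [EuclideanSpace.norm_sq_eq]; simp [dotProduct, sq]
  have := T.le_of_opNorm_le hn (WithLp.toLp 2 z)
  have h2 := pow_le_pow_left₀ (norm_nonneg _) this 2
  rw [mul_pow, hsq, hsq, hT] at h2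
  exact h2

instance unif01_prob : IsProbabilityMeasure (volume.restrict (Set.Icc (0:ℝ) 1)) :=
  ⟨by simp⟩

instance pairUniform_prob (n : ℕ) : IsProbabilityMeasure (pairUniform n) := by
  unfold pairUniform; infer_instance

lemma bilin_symm {n : ℕ} (E : Matrix (Fin n) (Fin n) ℝ) (hE : ∀ i j, E i j = E j i)
    (x y : Fin n → ℝ) :
    x ⬝ᵥ E *ᵥ y = (∑ q : Fin n × Fin n,
      (if q.1 < q.2 then x q.1 * y q.2 + x q.2 * y q.1 else 0) * E q.1 q.2)
      + ∑ i, E i i * (x i * y i) := by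
  have e0 : x ⬝ᵥ E *ᵥ y = ∑ i, ∑ j, x i * y j * E i j := by
    simp only [dotProduct, Matrix.mulVec, Finset.mul_sum]
    exact Finset.sum_congr rfl fun i _ => Finset.sum_congr rfl fun j _ => by ring
  have e1 : ∀ i j : Fin n, x i * y j * E i j
      = ((if i < j then x i * y j * E i j else 0) + (if j < i then x i * y j * E i j else 0))
        + (if i = j then x i * y j * E i j else 0) := by
    intro i j
    rcases lt_trichotomy i j with h | h | h
    · simp [h, h.ne, h.not_gt]
    · simp [h]
    · simp [h, h.ne', h.not_gt]
  rw [e0, Fintype.sum_prod_type]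
  rw [Finset.sum_congr rfl fun i _ => Finset.sum_congr rfl fun j _ => e1 i j]
  simp only [Finset.sum_add_distrib]
  congr 1
  · rw [Finset.sum_comm (f := fun i j => if j < i then x i * y j * E i j else 0),
      ← Finset.sum_add_distrib]
    refine Finset.sum_congr rfl fun i _ => ?_
    rw [← Finset.sum_add_distrib]
    refine Finset.sum_congr rfl fun j _ => ?_
    by_cases h : i < j
    · simp only [h, if_true]; rw [hE j i]; ring
    · simp [h]
  · refine Finset.sum_congr rfl fun i _ => ?_
    simp; ring

lemma dotd_comm {d : ℕ} (x y : Fin d → ℝ) : dotd x y = dotd y x :=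
  Finset.sum_congr rfl fun _ _ => mul_comm _ _

lemma adjOf_symm {d n : ℕ} (X : Fin n → Fin d → ℝ) (u : Fin n × Fin n → ℝ) (i j : Fin n) :
    adjOf 1 X u i j = adjOf 1 X u j i := by
  simp only [adjOf, eq_comm (a := i), min_comm i, max_comm i, dotd_comm (X i)]

lemma integral_ind_unif {p : ℝ} (h0 : 0 ≤ p) (h1 : p ≤ 1) :
    ∫ t, (if t < p then (1:ℝ) else 0) ∂(volume.restrict (Set.Icc (0:ℝ) 1)) = p := by
  have : (fun t : ℝ => if t < p then (1:ℝ) else 0) = (Set.Iio p).indicator 1 := by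
    ext t; simp [Set.indicator]
  rw [this, integral_indicator_one measurableSet_Iio, measureReal_restrict_apply measurableSet_Iio]
  have : Set.Iio p ∩ Set.Icc (0:ℝ) 1 = Set.Ico 0 p := by
    ext t; simp only [Set.mem_inter_iff, Set.mem_Iio, Set.mem_Icc, Set.mem_Ico]
    constructor
    · rintro ⟨a, b, c⟩; exact ⟨b, a⟩
    · rintro ⟨a, b⟩; exact ⟨b, a, by linarith⟩
  rw [this]; simp [h0]

open ProbabilityTheory in
lemma subg_mono {Ω : Type*} {m : MeasurableSpace Ω} {μ : Measure Ω} {X : Ω → ℝ} {c c' : ℝ≥0}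
    (h : HasSubgaussianMGF X c μ) (hc : c ≤ c') : HasSubgaussianMGF X c' μ where
  integrable_exp_mul := h.integrable_exp_mul
  mgf_le t := (h.mgf_le t).trans (by
    apply Real.exp_le_exp.mpr
    have : (c:ℝ) ≤ c' := by exact_mod_cast hc
    gcongr)

open ProbabilityTheory in
/-- Hoeffding tail bound for a fixed bilinear form of the noise matrix. -/
lemma tail_bilin {d n : ℕ} (X : Fin n → Fin d → ℝ)
    (hX : ∀ i j, 0 ≤ dotd (X i) (X j) ∧ dotd (X i) (X j) ≤ 1)
    (x y : Fin n → ℝ) (hx : x ⬝ᵥ x ≤ 4) (hy : y ⬝ᵥ y ≤ 4) (s : ℝ) (hs : 0 ≤ s) :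
    (pairUniform n).real {u | s + 4 ≤
      x ⬝ᵥ (Matrix.of (adjOf 1 X u) - Matrix.of X * (Matrix.of X)ᵀ) *ᵥ y}
      ≤ Real.exp (-s^2/32) := by
  let P : Fin n × Fin n → ℝ := fun q => dotd (X q.1) (X q.2)
  let c : Fin n × Fin n → ℝ := fun q =>
    if q.1 < q.2 then x q.1 * y q.2 + x q.2 * y q.1 else 0
  let B : Fin n × Fin n → ℝ → ℝ := fun q t => if t < P q then 1 else 0
  have hBm : ∀ q, Measurable (B q) := fun q =>
    Measurable.ite measurableSet_Iio measurable_const measurable_const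
  let Z : Fin n × Fin n → (Fin n × Fin n → ℝ) → ℝ := fun q u => c q * (B q (u q) - P q)
  have hint : ∀ q, ∫ u, B q (u q) ∂(pairUniform n) = P q := by
    intro q
    have hmp := measurePreserving_eval
      (fun _ : Fin n × Fin n => volume.restrict (Set.Icc (0:ℝ) 1)) q
    have := integral_map (μ := pairUniform n) (φ := Function.eval q) (f := B q)
      hmp.measurable.aemeasurable (hBm q).aestronglyMeasurable
    unfold pairUniform at this ⊢
    rw [hmp.map_eq] at this
    exact this.symm.trans (integral_ind_unif (hX q.1 q.2).1 (hX q.1 q.2).2)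
  have hsub : ∀ q, HasSubgaussianMGF (Z q) (‖c q‖₊^2 / 4) (pairUniform n) := by
    intro q
    have h1 := hasSubgaussianMGF_of_mem_Icc (μ := pairUniform n) (X := fun u => B q (u q))
      (a := 0) (b := 1) ((hBm q).comp (measurable_pi_apply q)).aemeasurable
      (Filter.Eventually.of_forall fun u => by
        simp only [B]; split_ifs <;> simp)
    rw [hint q] at h1
    have h2 := h1.const_mul (c q)
    refine subg_mono h2 (le_of_eq ?_)
    ext
    change (c q)^2 * (((‖(1:ℝ) - 0‖₊ / 2)^2 : ℝ≥0) : ℝ) = _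
    simp
    ring
  have hind : iIndepFun Z (pairUniform n) :=
    iIndepFun_pi (X := fun q t => c q * (B q t - P q))
      (fun q => (((hBm q).sub_const _).const_mul _).aemeasurable)
  have hsum := HasSubgaussianMGF.sum_of_iIndepFun hind (s := Finset.univ) (fun q _ => hsub q)
  have hcs : ∑ q, ‖c q‖₊^2 / 4 ≤ (16 : ℝ≥0) := by
    rw [← NNReal.coe_le_coe]
    push_cast
    have h1 : ∀ q, ‖c q‖^2 / 4 ≤ (1/2) * ((x q.1)^2 * (y q.2)^2 + (x q.2)^2 * (y q.1)^2) := by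
      intro q
      rw [Real.norm_eq_abs, sq_abs]
      simp only [c]
      split_ifs
      · nlinarith [sq_nonneg (x q.1 * y q.2 - x q.2 * y q.1)]
      · simp; positivity
    refine (Finset.sum_le_sum fun q _ => h1 q).trans ?_
    have h2 : ∑ q : Fin n × Fin n, (1/2:ℝ) * ((x q.1)^2 * (y q.2)^2 + (x q.2)^2 * (y q.1)^2)
        = (x ⬝ᵥ x) * (y ⬝ᵥ y) := by
      rw [← Finset.mul_sum, Finset.sum_add_distrib, Fintype.sum_prod_type, Fintype.sum_prod_type,
        Finset.sum_comm (f := fun i j => x j ^2 * y i ^2)]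
      simp only [dotProduct, Finset.sum_mul_sum]
      simp only [sq]
      ring
    rw [h2]
    have h3 : 0 ≤ y ⬝ᵥ y := Finset.sum_nonneg fun i _ => mul_self_nonneg _
    nlinarith
  have htail := (subg_mono hsum hcs).measure_ge_le hs
  have hexp : -s^2 / (2 * ((16:ℝ≥0):ℝ)) = -s^2/32 := by norm_num
  rw [hexp] at htail
  refine le_trans (measureReal_mono ?_) htail
  intro u hu
  simp only [Set.mem_ofPred_eq] at hu ⊢
  set E := Matrix.of (adjOf 1 X u) - Matrix.of X * (Matrix.of X)ᵀ with hEdef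
  have hEe : ∀ i j, E i j = adjOf 1 X u i j - dotd (X i) (X j) := by
    intro i j
    simp [hEdef, Matrix.mul_apply, dotd]
  rw [bilin_symm E (fun i j => by rw [hEe, hEe, adjOf_symm, dotd_comm])] at hu
  have h1 : ∑ q : Fin n × Fin n,
      (if q.1 < q.2 then x q.1 * y q.2 + x q.2 * y q.1 else 0) * E q.1 q.2
      = ∑ q, Z q u := by
    refine Finset.sum_congr rfl fun q _ => ?_
    simp only [Z, c]
    by_cases h : q.1 < q.2
    · simp only [h, if_true, hEe]
      congr 2
      simp [adjOf, h.ne, min_eq_left h.le, max_eq_right h.le, B, P]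
    · simp [h]
  have h2 : ∑ i, E i i * (x i * y i) ≤ 4 := by
    have h3 : ∀ i, E i i * (x i * y i) ≤ (1/2) * (x i * x i + y i * y i) := by
      intro i
      have he : E i i = - dotd (X i) (X i) := by rw [hEe]; simp [adjOf]
      rw [he]
      obtain ⟨a, b⟩ := hX i i
      have h4 := mul_nonneg (sub_nonneg.mpr b) (add_nonneg (mul_self_nonneg (x i)) (mul_self_nonneg (y i)))
      nlinarith [mul_nonneg a (sq_nonneg (x i + y i))]
    refine (Finset.sum_le_sum fun i _ => h3 i).trans ?_
    rw [← Finset.mul_sum, Finset.sum_add_distrib]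
    simp only [dotProduct] at hx hy
    linarith
  rw [h1] at hu
  linarith

lemma measurable_dotd {d : ℕ} {α : Type*} [MeasurableSpace α] {f g : α → Fin d → ℝ}
    (hf : Measurable f) (hg : Measurable g) : Measurable fun a => dotd (f a) (g a) := by
  unfold dotd
  exact Finset.measurable_sum _ fun k _ =>
    ((measurable_pi_apply k).comp hf).mul ((measurable_pi_apply k).comp hg)

lemma measurable_adjOf {d n : ℕ} :
    Measurable fun p : (Fin n × Fin n → ℝ) × (Fin n → Fin d → ℝ) => adjOf 1 p.2 p.1 := by
  refine measurable_pi_iff.mpr fun i => measurable_pi_iff.mpr fun j => ?_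
  unfold adjOf
  by_cases h : i = j
  · simp [h]
  · simp only [h, if_false]
    refine Measurable.ite (measurableSet_lt ?_ ?_) measurable_const measurable_const
    · exact (measurable_pi_apply _).comp measurable_fst
    · exact (measurable_dotd ((measurable_pi_apply i).comp measurable_snd)
        ((measurable_pi_apply j).comp measurable_snd)).const_mul _

/-- The good event: the noise matrix is small on a net. -/
def goodNet {d n : ℕ} (N : Finset (EuclideanSpace ℝ (Fin n)))
    (p : (Fin n × Fin n → ℝ) × (Fin n → Fin d → ℝ)) : Prop :=
  ∀ x ∈ N, ∀ y ∈ N, x.ofLp ⬝ᵥ (Matrix.of (adjOf 1 p.2 p.1) - Matrix.of p.2 * (Matrix.of p.2)ᵀ)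
    *ᵥ y.ofLp ≤ 14 * √n + 4

lemma measurableSet_goodNet {d n : ℕ} (N : Finset (EuclideanSpace ℝ (Fin n))) :
    MeasurableSet {p : (Fin n × Fin n → ℝ) × (Fin n → Fin d → ℝ) | goodNet N p} := by
  have e : {p : (Fin n × Fin n → ℝ) × (Fin n → Fin d → ℝ) | goodNet N p} =
      ⋂ x ∈ N, ⋂ y ∈ N, {p | x.ofLp ⬝ᵥ (Matrix.of (adjOf 1 p.2 p.1)
        - Matrix.of p.2 * (Matrix.of p.2)ᵀ) *ᵥ y.ofLp ≤ 14 * √n + 4} := by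
    ext p; simp [goodNet]
  rw [e]
  refine Finset.measurableSet_biInter _ fun x _ => Finset.measurableSet_biInter _ fun y _ => ?_
  refine measurableSet_le ?_ measurable_const
  simp only [dotProduct, Matrix.mulVec, Matrix.sub_apply, Matrix.mul_apply, Matrix.of_apply,
    Matrix.transpose_apply]
  refine Finset.measurable_sum _ fun i _ => Measurable.const_mul ?_ _
  refine Finset.measurable_sum _ fun j _ => Measurable.mul_const ?_ _
  refine Measurable.sub ?_ ?_
  · exact (measurable_pi_apply j).comp ((measurable_pi_apply i).comp measurable_adjOf)
  · exact measurable_dotd ((measurable_pi_apply i).comp measurable_snd)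
        ((measurable_pi_apply j).comp measurable_snd)

lemma bad_fixed {d n : ℕ} (N : Finset (EuclideanSpace ℝ (Fin n)))
    (hc : N.card ≤ 5^n) (hN : ∀ x ∈ N, ‖x‖ ≤ 2) (X : Fin n → Fin d → ℝ)
    (hX : ∀ i j, 0 ≤ dotd (X i) (X j) ∧ dotd (X i) (X j) ≤ 1) :
    (pairUniform n) {u | ¬ goodNet N (u, X)} ≤ ENNReal.ofReal (Real.exp (-n)) := by
  have hsq : ∀ y : EuclideanSpace ℝ (Fin n), ‖y‖^2 = y.ofLp ⬝ᵥ y.ofLp := fun y => by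
    rw [EuclideanSpace.norm_sq_eq]; simp [dotProduct, sq]
  have hN4 : ∀ x ∈ N, x.ofLp ⬝ᵥ x.ofLp ≤ 4 := fun x hx => by
    rw [← hsq]; nlinarith [hN x hx, norm_nonneg x]
  let T : EuclideanSpace ℝ (Fin n) × EuclideanSpace ℝ (Fin n) → Set (Fin n × Fin n → ℝ) :=
    fun xy => {u | 14 * √n + 4 ≤ xy.1.ofLp ⬝ᵥ
      (Matrix.of (adjOf 1 X u) - Matrix.of X * (Matrix.of X)ᵀ) *ᵥ xy.2.ofLp}
  have hsub : {u | ¬ goodNet N (u, X)} ⊆ ⋃ xy ∈ N ×ˢ N, T xy := by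
    intro u hu
    simp only [goodNet, Set.mem_ofPred_eq] at hu
    push Not at hu
    obtain ⟨x, hx, y, hy, h⟩ := hu
    simp only [Set.mem_iUnion]
    exact ⟨(x, y), Finset.mem_product.mpr ⟨hx, hy⟩, h.le⟩
  refine ENNReal.le_ofReal_iff_toReal_le (measure_ne_top _ _) (Real.exp_pos _).le |>.mpr ?_
  change (pairUniform n).real _ ≤ _
  refine (measureReal_mono hsub (measure_ne_top _ _)).trans ((measureReal_biUnion_finset_le _ _).trans ?_)
  have hT : ∀ xy ∈ N ×ˢ N, (pairUniform n).real (T xy) ≤ Real.exp (-(14 * √n)^2/32) := by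
    intro xy hxy
    obtain ⟨h1, h2⟩ := Finset.mem_product.mp hxy
    exact tail_bilin X hX _ _ (hN4 _ h1) (hN4 _ h2) (14 * √n) (by positivity)
  refine (Finset.sum_le_card_nsmul _ _ _ hT).trans ?_
  rw [nsmul_eq_mul, Finset.card_product]
  have h5 : ((N.card * N.card : ℕ) : ℝ) ≤ Real.exp (5 * n) := by
    have h25 : (25:ℝ) ≤ Real.exp 5 := by
      have h2 : (2:ℝ) ≤ Real.exp 1 := by linarith [Real.add_one_le_exp (1:ℝ)]
      have : Real.exp 5 = (Real.exp 1)^5 := by rw [← Real.exp_nat_mul]; norm_num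
      rw [this]
      calc (25:ℝ) ≤ 2^5 := by norm_num
        _ ≤ _ := pow_le_pow_left₀ (by norm_num) h2 5
    calc ((N.card * N.card : ℕ) : ℝ) ≤ ((5^n * 5^n : ℕ) : ℝ) := by
          exact_mod_cast Nat.mul_le_mul hc hc
      _ = 25^n := by push_cast; rw [← mul_pow]; norm_num
      _ ≤ (Real.exp 5)^n := pow_le_pow_left₀ (by norm_num) h25 n
      _ = _ := by rw [← Real.exp_nat_mul, mul_comm]
  refine (mul_le_mul_of_nonneg_right h5 (Real.exp_pos _).le).trans ?_
  rw [← Real.exp_add]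
  apply Real.exp_le_exp.mpr
  rw [mul_pow, Real.sq_sqrt (by positivity)]
  have : (0:ℝ) ≤ n := by positivity
  linarith

lemma msupport_ae {d : ℕ} (F : Measure (Fin d → ℝ)) : ∀ᵐ x ∂F, x ∈ msupport F := by
  have h : msupport F = F.support := by
    rw [Measure.support_eq_forall_isOpen]
    ext x
    simp only [msupport, Set.mem_ofPred_eq]
    exact ⟨fun h U hx hU => h U hU hx, fun h U hU hx => h U hx hU⟩
  rw [h]
  exact Measure.support_mem_ae

lemma bad_total {d n : ℕ} (F : Measure (Fin d → ℝ)) [IsProbabilityMeasure F]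
    (hF : InnerProductDistribution d F) (N : Finset (EuclideanSpace ℝ (Fin n)))
    (hc : N.card ≤ 5^n) (hN : ∀ x ∈ N, ‖x‖ ≤ 2) :
    ((pairUniform n).prod (Measure.pi fun _ : Fin n => F)) {p | ¬ goodNet N p}
      ≤ ENNReal.ofReal (Real.exp (-n)) := by
  have hm : MeasurableSet {p : (Fin n × Fin n → ℝ) × (Fin n → Fin d → ℝ) | ¬ goodNet N p} :=
    (measurableSet_goodNet N).compl
  rw [Measure.prod_apply_symm hm]
  have hae : ∀ᵐ X ∂(Measure.pi fun _ : Fin n => F), ∀ i, X i ∈ msupport F :=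
    ae_all_iff.mpr fun i =>
      (measurePreserving_eval (fun _ : Fin n => F) i).quasiMeasurePreserving.ae (msupport_ae F)
  calc _ ≤ ∫⁻ _, ENNReal.ofReal (Real.exp (-n)) ∂(Measure.pi fun _ : Fin n => F) := by
        refine lintegral_mono_ae ?_
        filter_upwards [hae] with X hX
        exact bad_fixed N hc hN X fun i j => hF.2 _ (hX i) _ (hX j)
    _ = _ := by simp

lemma uniformFin_prob {n : ℕ} (hn : n ≠ 0) : IsProbabilityMeasure (uniformFin n) := by
  refine ⟨?_⟩
  unfold uniformFin
  rw [Measure.smul_apply, Measure.count_univ]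
  simp only [ENat.card_eq_coe_fintype_card, Fintype.card_fin]
  change (((n : ℝ≥0)⁻¹ : ℝ≥0) : ℝ≥0∞) * ((n : ℕ∞) : ℝ≥0∞) = 1
  rw [ENNReal.coe_inv (by exact_mod_cast hn)]
  simp only [ENNReal.coe_natCast, ENat.toENNReal_coe]
  exact ENNReal.inv_mul_cancel (by exact_mod_cast hn) (by simp)

instance uniformFin_finite (n : ℕ) : IsFiniteMeasure (uniformFin n) := by
  unfold uniformFin; infer_instance

lemma empMeasure_eq_map {d n : ℕ} (Y : Fin n → Fin d → ℝ) :
    empMeasure Y = (uniformFin n).map Y := by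
  unfold empMeasure uniformFin
  rw [Measure.map_smul, Measure.count, Measure.map_sum (by fun_prop)]
  simp [Measure.map_dirac' (measurable_of_finite Y), Measure.sum_fintype]

/-- The bootstrap randomness. -/
def bootSpace (n : ℕ) : Measure ((Fin n × Fin n → ℝ) × (Fin n → Fin n)) :=
  (pairUniform n).prod (Measure.pi fun _ => uniformFin n)

instance bootSpace_finite (n : ℕ) : IsFiniteMeasure (bootSpace n) := by
  unfold bootSpace; infer_instance

lemma bootSpace_prob {n : ℕ} (hn : n ≠ 0) : IsProbabilityMeasure (bootSpace n) := by
  have := uniformFin_prob hn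
  unfold bootSpace; infer_instance

lemma measurable_comp_index {d n : ℕ} :
    Measurable fun p : (Fin n → Fin d → ℝ) × (Fin n → Fin n) => p.1 ∘ p.2 := by
  refine measurable_from_prod_countable_left fun ι => ?_
  exact measurable_pi_iff.mpr fun k => measurable_pi_apply _

/-- Bootstrap adjacency matrix as a measurable function. -/
def bootAdj {d n : ℕ} (p : (Fin n → Fin d → ℝ) × ((Fin n × Fin n → ℝ) × (Fin n → Fin n))) :
    Fin n → Fin n → ℝ := adjOf 1 (p.1 ∘ p.2.2) p.2.1

lemma measurable_bootAdj {d n : ℕ} : Measurable (bootAdj (d := d) (n := n)) := by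
  have h : Measurable fun p : (Fin n → Fin d → ℝ) × ((Fin n × Fin n → ℝ) × (Fin n → Fin n)) =>
      (p.2.1, p.1 ∘ p.2.2) :=
    (measurable_fst.comp measurable_snd).prodMk
      (measurable_comp_index.comp (measurable_fst.prodMk (measurable_snd.comp measurable_snd)))
  exact measurable_adjOf.comp h

lemma adjLaw_eq {d n : ℕ} (G : Measure (Fin d → ℝ)) [SigmaFinite G] :
    adjLaw d n G = ((pairUniform n).prod (Measure.pi fun _ : Fin n => G)).map
      (fun p => adjOf 1 p.2 p.1) := by
  unfold adjLaw rdpgLaw rdpgLawOf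
  rw [Measure.map_map measurable_fst (measurable_adjOf.prodMk measurable_snd)]
  rfl

lemma adjLaw_emp {d n : ℕ} (Y : Fin n → Fin d → ℝ) :
    adjLaw d n (empMeasure Y) = (bootSpace n).map (fun w => bootAdj (Y, w)) := by
  rw [adjLaw_eq]
  have h1 : (Measure.pi fun _ : Fin n => empMeasure Y)
      = (Measure.pi fun _ : Fin n => uniformFin n).map (fun ι => Y ∘ ι) := by
    have := Measure.pi_map_pi (μ := fun _ : Fin n => uniformFin n) (f := fun _ => Y)
      (fun _ => (measurable_of_finite Y).aemeasurable)
    simp only [← empMeasure_eq_map] at this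
    exact this.symm
  have h2 : (pairUniform n) = (pairUniform n).map id := Measure.map_id.symm
  have hm : Measurable (fun ι : Fin n → Fin n => Y ∘ ι) := measurable_of_finite _
  rw [h1]
  nth_rewrite 1 [h2]
  rw [Measure.map_prod_map _ _ measurable_id hm,
    Measure.map_map measurable_adjOf (measurable_id.prodMap hm)]
  rfl

lemma bind_map_eq {α β γ : Type*} [MeasurableSpace α] [MeasurableSpace β] [MeasurableSpace γ]
    (μ : Measure α) (ν : Measure β) [SFinite μ] [SFinite ν] (g : α × β → γ) (hg : Measurable g) :
    (μ.bind fun x => ν.map fun y => g (x, y)) = (μ.prod ν).map g := by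
  have hk : Measurable fun x => ν.map fun y => g (x, y) := by
    refine Measure.measurable_of_measurable_coe _ fun s hs => ?_
    have : ∀ x, (ν.map fun y => g (x, y)) s = ν (Prod.mk x ⁻¹' (g ⁻¹' s)) := fun x => by
      have hx : Measurable (fun y => g (x, y)) := hg.comp measurable_prodMk_left
      rw [Measure.map_apply hx hs]; rfl
    simp_rw [this]
    exact measurable_measure_prodMk_left (hg hs)
  ext s hs
  rw [Measure.bind_apply hs hk.aemeasurable, Measure.map_apply hg hs,
    Measure.prod_apply (hg hs)]
  refine lintegral_congr fun x => ?_
  have hx : Measurable (fun y => g (x, y)) := hg.comp measurable_prodMk_left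
  rw [Measure.map_apply hx hs]; rfl

/-- Binary matrices. -/
def binSet (n : ℕ) : Set (Fin n → Fin n → ℝ) := {a | ∀ i j, a i j = 0 ∨ a i j = 1}

lemma binSet_finite (n : ℕ) : (binSet n).Finite := by
  have : binSet n = Set.pi Set.univ fun _ => Set.pi Set.univ fun _ => ({0, 1} : Set ℝ) := by
    ext a; simp [binSet]
  rw [this]
  exact Set.Finite.pi fun _ => Set.Finite.pi fun _ => Set.toFinite _

lemma adjOf_mem_binSet {d n : ℕ} (X : Fin n → Fin d → ℝ) (u : Fin n × Fin n → ℝ) :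
    adjOf 1 X u ∈ binSet n := by
  intro i j; unfold adjOf; split_ifs <;> simp

/-- A measurable version of the spectral embedding. -/
def aseM (d : ℕ) {n : ℕ} (a : Fin n → Fin n → ℝ) : Fin n → Fin d → ℝ :=
  if a ∈ binSet n then ase d a else 0

lemma measurable_aseM (d n : ℕ) : Measurable (aseM d (n := n)) := by
  intro t ht
  have e : aseM d (n := n) ⁻¹' t = (binSet n ∩ {a | ase d a ∈ t}) ∪
      ((binSet n)ᶜ ∩ {_a | (0 : Fin n → Fin d → ℝ) ∈ t}) := by
    ext a
    by_cases h : a ∈ binSet n <;> simp [aseM, h]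
  rw [e]
  refine ((binSet_finite n).subset Set.inter_subset_left).measurableSet.union ?_
  exact (binSet_finite n).measurableSet.compl.inter (MeasurableSet.const _)

/-- The full probability space carrying the coupling. -/
def cplSpace {d : ℕ} (n : ℕ) (F : Measure (Fin d → ℝ)) [SigmaFinite F] :
    Measure (((Fin n × Fin n → ℝ) × (Fin n → Fin d → ℝ)) ×
      ((Fin n × Fin n → ℝ) × (Fin n → Fin n))) :=
  ((pairUniform n).prod (Measure.pi fun _ : Fin n => F)).prod (bootSpace n)

def cplFst {d n : ℕ} (ω : ((Fin n × Fin n → ℝ) × (Fin n → Fin d → ℝ)) ×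
      ((Fin n × Fin n → ℝ) × (Fin n → Fin n))) : Fin n → Fin n → ℝ :=
  bootAdj (ω.1.2, ω.2)

def cplSnd {d n : ℕ} (ω : ((Fin n × Fin n → ℝ) × (Fin n → Fin d → ℝ)) ×
      ((Fin n × Fin n → ℝ) × (Fin n → Fin n))) : Fin n → Fin n → ℝ :=
  bootAdj (aseM d (adjOf 1 ω.1.2 ω.1.1), ω.2)

lemma measurable_cplFst {d n : ℕ} : Measurable (cplFst (d := d) (n := n)) :=
  measurable_bootAdj.comp ((measurable_snd.comp measurable_fst).prodMk measurable_snd)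

lemma measurable_cplSnd {d n : ℕ} : Measurable (cplSnd (d := d) (n := n)) :=
  measurable_bootAdj.comp
    (((measurable_aseM d n).comp (measurable_adjOf.comp measurable_fst)).prodMk measurable_snd)

lemma map_cplFst {d n : ℕ} (F : Measure (Fin d → ℝ)) [IsProbabilityMeasure F] :
    (cplSpace n F).map cplFst
      = (Measure.pi fun _ : Fin n => F).bind fun x => adjLaw d n (empMeasure x) := by
  simp_rw [adjLaw_emp]
  rw [bind_map_eq _ _ _ measurable_bootAdj]
  have h1 : (Measure.pi fun _ : Fin n => F)
      = ((pairUniform n).prod (Measure.pi fun _ : Fin n => F)).map Prod.snd := by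
    rw [Measure.map_snd_prod]; simp
  have h2 : (bootSpace n) = (bootSpace n).map id := Measure.map_id.symm
  rw [h1]
  nth_rewrite 1 [h2]
  rw [Measure.map_prod_map _ _ measurable_snd measurable_id,
    Measure.map_map measurable_bootAdj (measurable_snd.prodMap measurable_id)]
  rfl

lemma map_cplSnd {d n : ℕ} (F : Measure (Fin d → ℝ)) [IsProbabilityMeasure F] :
    (cplSpace n F).map cplSnd = bootLaw d n F := by
  unfold bootLaw
  simp_rw [adjLaw_emp]
  have hF : SFinite (adjLaw d n F) := by rw [adjLaw_eq]; infer_instance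
  have hae : (fun a => (bootSpace n).map fun w => bootAdj (ase d a, w))
      =ᵐ[adjLaw d n F] fun a => (bootSpace n).map fun w => bootAdj (aseM d a, w) := by
    have : ∀ᵐ a ∂(adjLaw d n F), a ∈ binSet n := by
      rw [adjLaw_eq]
      refine (ae_map_iff measurable_adjOf.aemeasurable (p := fun a => a ∈ binSet n)
        (binSet_finite n).measurableSet).mpr ?_
      exact Filter.Eventually.of_forall fun p => adjOf_mem_binSet _ _
    filter_upwards [this] with a ha
    simp [aseM, ha]
  have hm : Measurable fun p : (Fin n → Fin n → ℝ) × ((Fin n × Fin n → ℝ) × (Fin n → Fin n)) =>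
      bootAdj (aseM d p.1, p.2) :=
    measurable_bootAdj.comp (((measurable_aseM d n).comp measurable_fst).prodMk measurable_snd)
  rw [Measure.bind_congr_right hae, bind_map_eq _ _ _ hm]
  have h2 : (bootSpace n) = (bootSpace n).map id := Measure.map_id.symm
  rw [adjLaw_eq]
  nth_rewrite 1 [h2]
  rw [Measure.map_prod_map _ _ measurable_adjOf measurable_id,
    Measure.map_map hm (measurable_adjOf.prodMap measurable_id)]
  rfl

lemma unif_diff {n : ℕ} (q : Fin n × Fin n) (a b : ℝ) :
    pairUniform n {v | (if v q < a then (1:ℝ) else 0) ≠ (if v q < b then 1 else 0)}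
      ≤ ENNReal.ofReal |a - b| := by
  have hmp : MeasurePreserving (Function.eval q) (pairUniform n)
      (volume.restrict (Set.Icc (0:ℝ) 1)) :=
    measurePreserving_eval (fun _ : Fin n × Fin n => volume.restrict (Set.Icc (0:ℝ) 1)) q
  calc _ ≤ pairUniform n (Function.eval q ⁻¹' Set.Ico (min a b) (max a b)) := by
        refine measure_mono fun v hv => ?_
        have hv' : (if v q < a then (1:ℝ) else 0) ≠ (if v q < b then 1 else 0) := hv
        change min a b ≤ v q ∧ v q < max a b
        rw [min_le_iff, lt_max_iff]
        split_ifs at hv' with h1 h2 h2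
        · exact absurd rfl hv'
        · exact ⟨Or.inr (not_lt.mp h2), Or.inl h1⟩
        · exact ⟨Or.inl (not_lt.mp h1), Or.inr h2⟩
        · exact absurd rfl hv'
    _ = (volume.restrict (Set.Icc (0:ℝ) 1)) (Set.Ico (min a b) (max a b)) :=
        hmp.measure_preimage measurableSet_Ico.nullMeasurableSet
    _ ≤ volume (Set.Ico (min a b) (max a b)) := Measure.restrict_apply_le _ _
    _ = ENNReal.ofReal |a - b| := by rw [Real.volume_Ico, max_sub_min_eq_abs']

lemma lintegral_pair {n : ℕ} (hn : n ≠ 0) {i j : Fin n} (hij : i ≠ j)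
    (f : Fin n → Fin n → ℝ≥0∞) :
    ∫⁻ ι, f (ι i) (ι j) ∂(Measure.pi fun _ : Fin n => uniformFin n)
      = (n : ℝ≥0∞)⁻¹ * ((n : ℝ≥0∞)⁻¹ * ∑ k, ∑ l, f k l) := by
  have := uniformFin_prob hn
  have hind : ProbabilityTheory.iIndepFun (fun (i : Fin n) (ι : Fin n → Fin n) => ι i)
      (Measure.pi fun _ : Fin n => uniformFin n) :=
    ProbabilityTheory.iIndepFun_pi (X := fun _ x => x) (fun _ => aemeasurable_id)
  have h2 := hind.indepFun hij
  rw [ProbabilityTheory.indepFun_iff_map_prod_eq_prod_map_map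
    (measurable_pi_apply i).aemeasurable (measurable_pi_apply j).aemeasurable] at h2
  have hi : ∀ i, (Measure.pi fun _ : Fin n => uniformFin n).map (fun ι : Fin n → Fin n => ι i)
      = uniformFin n := fun i =>
    (measurePreserving_eval (fun _ : Fin n => uniformFin n) i).map_eq
  rw [hi, hi] at h2
  have h3 : ∫⁻ ι, f (ι i) (ι j) ∂(Measure.pi fun _ : Fin n => uniformFin n)
      = ∫⁻ kl, f kl.1 kl.2 ∂((uniformFin n).prod (uniformFin n)) := by
    rw [← h2, lintegral_map (measurable_of_finite _)
      ((measurable_pi_apply i).prodMk (measurable_pi_apply j))]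
  have h4 : ∀ g : Fin n → ℝ≥0∞, ∫⁻ k, g k ∂(uniformFin n) = (n : ℝ≥0∞)⁻¹ * ∑ k, g k := by
    intro g
    unfold uniformFin
    rw [lintegral_smul_measure, lintegral_count, tsum_fintype]
    change (((n : ℝ≥0)⁻¹ : ℝ≥0) : ℝ≥0∞) * _ = _
    rw [ENNReal.coe_inv (by exact_mod_cast hn)]
    simp
  rw [h3, lintegral_prod _ (measurable_of_finite _).aemeasurable, h4]
  simp_rw [h4]
  rw [← Finset.mul_sum]

lemma boot_diff {d n : ℕ} (hn : n ≠ 0) {i j : Fin n} (hij : i ≠ j)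
    (Y Yh : Fin n → Fin d → ℝ) :
    bootSpace n {w | bootAdj (Y, w) i j ≠ bootAdj (Yh, w) i j}
      ≤ ENNReal.ofReal (((n:ℝ)^2)⁻¹ *
        ∑ k, ∑ l, |dotd (Y k) (Y l) - dotd (Yh k) (Yh l)|) := by
  have hm : ∀ Y : Fin n → Fin d → ℝ, Measurable fun w => bootAdj (Y, w) i j := fun Y =>
    (measurable_pi_apply j).comp ((measurable_pi_apply i).comp
      (measurable_bootAdj.comp measurable_prodMk_left))
  have hs : MeasurableSet {w | bootAdj (Y, w) i j ≠ bootAdj (Yh, w) i j} :=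
    (measurableSet_eq_fun (hm Y) (hm Yh)).compl
  unfold bootSpace
  rw [Measure.prod_apply_symm hs]
  calc _ ≤ ∫⁻ ι : Fin n → Fin n, ENNReal.ofReal
        |dotd (Y (ι i)) (Y (ι j)) - dotd (Yh (ι i)) (Yh (ι j))|
        ∂(Measure.pi fun _ : Fin n => uniformFin n) := by
        refine lintegral_mono fun ι => ?_
        refine le_trans (le_of_eq ?_) (unif_diff (min i j, max i j) _ _)
        congr 1
        ext v
        simp [bootAdj, adjOf, hij]
    _ = _ := by
        rw [lintegral_pair hn hij (fun k l => ENNReal.ofReal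
          |dotd (Y k) (Y l) - dotd (Yh k) (Yh l)|)]
        have hn' : (0:ℝ) < n := by exact_mod_cast Nat.pos_of_ne_zero hn
        rw [ENNReal.ofReal_mul (by positivity), ENNReal.ofReal_sum_of_nonneg
          (fun k _ => Finset.sum_nonneg fun l _ => abs_nonneg _)]
        simp_rw [ENNReal.ofReal_sum_of_nonneg (fun l _ => abs_nonneg _)]
        rw [ENNReal.ofReal_inv_of_pos (by positivity), ENNReal.ofReal_pow hn'.le,
          ENNReal.ofReal_natCast, ← mul_assoc, pow_two,
          ENNReal.mul_inv (by simp) (by simp)]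

lemma cpl_diff {d n : ℕ} (hn : n ≠ 0) (hd : d ≤ n) (F : Measure (Fin d → ℝ))
    [IsProbabilityMeasure F] (hF : InnerProductDistribution d F) {i j : Fin n} (hij : i ≠ j) :
    cplSpace n F {ω | cplFst ω i j ≠ cplSnd ω i j}
      ≤ ENNReal.ofReal (54 * √(2 * d) / √n + Real.exp (-n)) := by
  obtain ⟨N, hc, hN, hnet⟩ := exists_net n
  have hn' : (0:ℝ) < n := by exact_mod_cast Nat.pos_of_ne_zero hn
  have hn1 : (1:ℝ) ≤ n := by exact_mod_cast Nat.one_le_iff_ne_zero.mpr hn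
  have := bootSpace_prob hn
  have hs : MeasurableSet {ω : ((Fin n × Fin n → ℝ) × (Fin n → Fin d → ℝ)) ×
      ((Fin n × Fin n → ℝ) × (Fin n → Fin n)) | cplFst ω i j ≠ cplSnd ω i j} :=
    (measurableSet_eq_fun
      ((measurable_pi_apply j).comp ((measurable_pi_apply i).comp measurable_cplFst))
      ((measurable_pi_apply j).comp ((measurable_pi_apply i).comp measurable_cplSnd))).compl
  have hb : MeasurableSet {p : (Fin n × Fin n → ℝ) × (Fin n → Fin d → ℝ) | ¬ goodNet N p} :=
    (measurableSet_goodNet N).compl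
  have hsq : 0 < √(n:ℝ) := Real.sqrt_pos.mpr hn'
  have hss : √(n:ℝ) * √n = n := Real.mul_self_sqrt hn'.le
  have hs1 : 1 ≤ √(n:ℝ) := Real.one_le_sqrt.mpr hn1
  unfold cplSpace
  rw [Measure.prod_apply hs]
  calc _ ≤ ∫⁻ p, (ENNReal.ofReal (54 * √(2 * d) / √n) +
        {p : (Fin n × Fin n → ℝ) × (Fin n → Fin d → ℝ) | ¬ goodNet N p}.indicator 1 p)
        ∂((pairUniform n).prod (Measure.pi fun _ : Fin n => F)) := by
        refine lintegral_mono fun p => ?_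
        by_cases hg : goodNet N p
        · refine le_trans ?_ le_self_add
          change bootSpace n {w | bootAdj (p.2, w) i j
            ≠ bootAdj (aseM d (adjOf 1 p.2 p.1), w) i j} ≤ _
          refine (boot_diff hn hij _ _).trans (ENNReal.ofReal_le_ofReal ?_)
          have hae : aseM d (adjOf 1 p.2 p.1) = ase d (adjOf 1 p.2 p.1) := by
            simp [aseM, adjOf_mem_binSet]
          rw [hae]
          have hE := mulVec_of_net N hnet _ (14 * √n + 4) (by positivity) hg
          have h1 := ase_l1 hd (adjOf 1 p.2 p.1)
            (by ext a b; exact adjOf_symm _ _ _ _) p.2 _ (by positivity) hE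
          calc _ ≤ ((n:ℝ)^2)⁻¹ * (n * (√(2 * d) * (3 * (14 * √n + 4)))) := by gcongr
            _ ≤ ((n:ℝ)^2)⁻¹ * (n * (√(2 * d) * (3 * (18 * √n)))) := by
                gcongr; linarith
            _ = 54 * √(2 * d) / √n := by
                nth_rewrite 1 2 [← hss]
                field_simp
                ring
        · refine le_trans prob_le_one ?_
          rw [Set.indicator_of_mem (by exact hg)]
          exact le_add_self
    _ = ENNReal.ofReal (54 * √(2 * d) / √n) +
        ((pairUniform n).prod (Measure.pi fun _ : Fin n => F)) {p | ¬ goodNet N p} := by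
        rw [lintegral_add_left measurable_const, lintegral_indicator_one hb]
        simp
    _ ≤ _ := by
        rw [ENNReal.ofReal_add (by positivity) (by positivity)]
        gcongr
        exact bad_total F hF N hc hN

lemma dGM_nonneg {n : ℕ} (A B : Fin n → Fin n → ℝ) : 0 ≤ dGM A B :=
  Real.iInf_nonneg fun σ => by positivity

lemma dGM_le {n : ℕ} (A B : Fin n → Fin n → ℝ) :
    dGM A B ≤ ((n.choose 2 : ℝ))⁻¹ * (∑ i, ∑ j, |A i j - B i j|) / 2 := by
  unfold dGM
  exact ciInf_le (Set.finite_range _).bddBelow (1 : Equiv.Perm (Fin n))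

lemma measurable_dGM {n : ℕ} :
    Measurable fun q : (Fin n → Fin n → ℝ) × (Fin n → Fin n → ℝ) => dGM q.1 q.2 := by
  unfold dGM
  refine Measurable.iInf fun σ => ?_
  fun_prop

lemma bootAdj_abs {d n : ℕ} (p q : (Fin n → Fin d → ℝ) × ((Fin n × Fin n → ℝ) × (Fin n → Fin n)))
    (i j : Fin n) : |bootAdj p i j - bootAdj q i j|
      = if bootAdj p i j ≠ bootAdj q i j then 1 else 0 := by
  rcases adjOf_mem_binSet (p.1 ∘ p.2.2) p.2.1 i j with h | h <;>
  rcases adjOf_mem_binSet (q.1 ∘ q.2.2) q.2.1 i j with h' | h' <;>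
  simp [bootAdj, h, h']

lemma sum_offdiag (n : ℕ) (c : ℝ) :
    ∑ i : Fin n, ∑ j : Fin n, (if i = j then 0 else c) = n * (n - 1) * c := by
  have : ∀ i : Fin n, ∑ j : Fin n, (if i = j then 0 else c) = (n - 1) * c := by
    intro i
    have h : ∀ j : Fin n, (if i = j then 0 else c) = c - if i = j then c else 0 := by
      intro j; split_ifs <;> simp
    simp_rw [h]
    rw [Finset.sum_sub_distrib]
    simp; ring
  simp [this]; ring

lemma WGMpow_nonneg {n : ℕ} (p : ℝ) (μ ν : Measure (Fin n → Fin n → ℝ)) : 0 ≤ WGMpow p μ ν := by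
  refine Real.sInf_nonneg ?_
  rintro _ ⟨γ, -, rfl⟩
  exact integral_nonneg fun q => Real.rpow_nonneg (dGM_nonneg _ _) _

lemma WGMpow_le {d n : ℕ} (hn : 2 ≤ n) (hd : d ≤ n) (F : Measure (Fin d → ℝ))
    [IsProbabilityMeasure F] (hF : InnerProductDistribution d F) (p : ℝ) (hp : 1 ≤ p) :
    WGMpow p ((Measure.pi fun _ : Fin n => F).bind fun x => adjLaw d n (empMeasure x))
          (bootLaw d n F) ≤ 54 * √(2 * d) / √n + Real.exp (-n) := by
  have hn0 : n ≠ 0 := by omega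
  have := bootSpace_prob hn0
  have hP : IsProbabilityMeasure (cplSpace n F) := by unfold cplSpace; infer_instance
  have hm2 := (measurable_cplFst (d := d) (n := n)).prodMk (measurable_cplSnd (d := d) (n := n))
  set R := 54 * √(2 * d) / √n + Real.exp (-n) with hR
  have hR0 : 0 ≤ R := by positivity
  let γ := (cplSpace n F).map fun ω => (cplFst ω, cplSnd ω)
  have hγ : γ ∈ Couplings ((Measure.pi fun _ : Fin n => F).bind fun x => adjLaw d n (empMeasure x))
      (bootLaw d n F) := by
    refine ⟨Measure.isProbabilityMeasure_map hm2.aemeasurable, ?_, ?_⟩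
    · rw [Measure.map_map measurable_fst hm2, ← map_cplFst]; rfl
    · rw [Measure.map_map measurable_snd hm2, ← map_cplSnd]; rfl
  have hbdd : BddBelow ((fun γ => ∫ q, dGM q.1 q.2 ^ p ∂γ) '' Couplings
      ((Measure.pi fun _ : Fin n => F).bind fun x => adjLaw d n (empMeasure x))
      (bootLaw d n F)) := by
    refine ⟨0, ?_⟩
    rintro _ ⟨γ, -, rfl⟩
    exact integral_nonneg fun q => Real.rpow_nonneg (dGM_nonneg _ _) _
  refine (csInf_le hbdd ⟨γ, hγ, rfl⟩).trans ?_
  change ∫ q, dGM q.1 q.2 ^ p ∂γ ≤ R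
  have hmp : Measurable fun q : (Fin n → Fin n → ℝ) × (Fin n → Fin n → ℝ) => dGM q.1 q.2 ^ p :=
    measurable_dGM.pow_const p
  rw [integral_map hm2.aemeasurable hmp.aestronglyMeasurable]
  let T : Fin n → Fin n → Set (((Fin n × Fin n → ℝ) × (Fin n → Fin d → ℝ)) ×
      ((Fin n × Fin n → ℝ) × (Fin n → Fin n))) := fun i j => {ω | cplFst ω i j ≠ cplSnd ω i j}
  have hT : ∀ i j, MeasurableSet (T i j) := fun i j =>
    (measurableSet_eq_fun
      ((measurable_pi_apply j).comp ((measurable_pi_apply i).comp measurable_cplFst))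
      ((measurable_pi_apply j).comp ((measurable_pi_apply i).comp measurable_cplSnd))).compl
  have hTd : ∀ i, T i i = ∅ := fun i => by
    ext ω; simp [T, cplFst, cplSnd, bootAdj, adjOf]
  have hTm : ∀ i j, (cplSpace n F).real (T i j) ≤ if i = j then 0 else R := by
    intro i j
    split_ifs with h
    · subst h; simp [hTd]
    · exact ENNReal.toReal_le_of_le_ofReal hR0 (cpl_diff hn0 hd F hF h)
  have hn2 : (2:ℝ) ≤ n := by exact_mod_cast hn
  have hch : (n.choose 2 : ℝ) = n * (n - 1) / 2 := Nat.cast_choose_two ℝ n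
  have hch0 : (0:ℝ) < n.choose 2 := by rw [hch]; nlinarith
  let g := fun ω => ((n.choose 2 : ℝ))⁻¹ * (∑ i, ∑ j, (T i j).indicator (fun _ => (1:ℝ)) ω) / 2
  have hint : ∀ i j, Integrable ((T i j).indicator (fun _ => (1:ℝ))) (cplSpace n F) :=
    fun i j => (integrable_const 1).indicator (hT i j)
  have hint2 : Integrable g (cplSpace n F) :=
    ((integrable_finsetSum _ fun i _ => integrable_finsetSum _ fun j _ => hint i j).const_mul
      _).div_const _
  have hle : ∀ ω, dGM (cplFst ω) (cplSnd ω) ^ p ≤ g ω := by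
    intro ω
    have h1 : dGM (cplFst ω) (cplSnd ω) ≤ g ω := by
      refine (dGM_le _ _).trans (le_of_eq ?_)
      simp only [g]
      congr 2
      refine Finset.sum_congr rfl fun i _ => Finset.sum_congr rfl fun j _ => ?_
      refine (bootAdj_abs (ω.1.2, ω.2) (aseM d (adjOf 1 ω.1.2 ω.1.1), ω.2) i j).trans ?_
      by_cases h : ω ∈ T i j
      · rw [Set.indicator_of_mem h]; exact if_pos h
      · rw [Set.indicator_of_notMem h]; exact if_neg h
    have h2 : g ω ≤ 1 := by
      have : ∑ i, ∑ j, (T i j).indicator (fun _ => (1:ℝ)) ω ≤ n * (n - 1) * 1 := by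
        rw [← sum_offdiag]
        refine Finset.sum_le_sum fun i _ => Finset.sum_le_sum fun j _ => ?_
        split_ifs with h
        · subst h; simp [hTd]
        · exact Set.indicator_le_self' (fun _ _ => zero_le_one) ω
      calc g ω ≤ ((n.choose 2 : ℝ))⁻¹ * (n * (n - 1) * 1) / 2 := by
            simp only [g]; gcongr
        _ = ((n.choose 2 : ℝ))⁻¹ * (n.choose 2 : ℝ) := by rw [hch]; ring
        _ = 1 := inv_mul_cancel₀ hch0.ne'
    have h0 := dGM_nonneg (cplFst ω) (cplSnd ω)
    calc dGM (cplFst ω) (cplSnd ω) ^ p ≤ dGM (cplFst ω) (cplSnd ω) ^ (1:ℝ) :=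
          Real.rpow_le_rpow_of_exponent_ge_of_imp h0 (h1.trans h2) hp (by intros; linarith)
      _ ≤ g ω := by rw [Real.rpow_one]; exact h1
  calc _ ≤ ∫ ω, g ω ∂(cplSpace n F) :=
        integral_mono_of_nonneg (Eventually.of_forall fun ω =>
          Real.rpow_nonneg (dGM_nonneg _ _) _) hint2 (Eventually.of_forall hle)
    _ = ((n.choose 2 : ℝ))⁻¹ * (∑ i, ∑ j, (cplSpace n F).real (T i j)) / 2 := by
        simp only [g]
        rw [integral_div, integral_const_mul, integral_finsetSum _
          fun i _ => integrable_finsetSum _ fun j _ => hint i j]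
        congr 2
        refine Finset.sum_congr rfl fun i _ => ?_
        rw [integral_finsetSum _ fun j _ => hint i j]
        refine Finset.sum_congr rfl fun j _ => ?_
        exact integral_indicator_one (hT i j)
    _ ≤ ((n.choose 2 : ℝ))⁻¹ * (n * (n - 1) * R) / 2 := by
        rw [← sum_offdiag]
        gcongr with i _ j _
        exact hTm i j
    _ = ((n.choose 2 : ℝ))⁻¹ * (n.choose 2 : ℝ) * R := by rw [hch]; ring
    _ = R := by rw [inv_mul_cancel₀ hch0.ne', one_mul]

open Asymptotics in
/-- the Wasserstein graph-matching distance between the oracle bootstrap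
`A* ~ RDPG(F_n, n)` (from the empirical distribution of the true latent positions) and the
ASE bootstrap `Â* ~ RDPG(F̂_n, n)` satisfies `W_{GM,p}^p(A*, Â*) = O(n^{-1/2} log n)`. -/
theorem oracle_vs_ase_bootstrap_wasserstein_rate
    {d : ℕ} (F : Measure (Fin d → ℝ)) [IsProbabilityMeasure F]
    (hF : InnerProductDistribution d F) :
    ∀ p : ℝ, 1 ≤ p →
      (fun n : ℕ => WGMpow p
          ((Measure.pi fun _ : Fin n => F).bind fun x => adjLaw d n (empMeasure x))
          (bootLaw d n F)) =O[atTop]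
        fun n : ℕ => (n : ℝ) ^ (-(1/2 : ℝ)) * Real.log n := by
  intro p hp
  refine IsBigO.of_bound (54 * √(2 * d) + 1) ?_
  filter_upwards [eventually_ge_atTop (max d 3)] with n hn
  have hd : d ≤ n := (le_max_left _ _).trans hn
  have h3 : 3 ≤ n := (le_max_right _ _).trans hn
  have h3' : (3:ℝ) ≤ n := by exact_mod_cast h3
  have hn0 : (0:ℝ) < n := by linarith
  have hlog : 1 ≤ Real.log n := by
    rw [Real.le_log_iff_exp_le hn0]
    linarith [Real.exp_one_lt_d9]
  have hsq : 0 < √(n:ℝ) := Real.sqrt_pos.mpr hn0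
  have hpow : (n : ℝ) ^ (-(1/2 : ℝ)) = (√(n:ℝ))⁻¹ := by
    rw [Real.rpow_neg hn0.le, Real.sqrt_eq_rpow]
  have hexp : Real.exp (-n) ≤ (√(n:ℝ))⁻¹ := by
    rw [Real.exp_neg]
    refine inv_anti₀ hsq ?_
    have h1 : √(n:ℝ) ≤ n := by
      rw [Real.sqrt_le_left hn0.le]; nlinarith
    linarith [Real.add_one_le_exp (n:ℝ)]
  rw [Real.norm_of_nonneg (WGMpow_nonneg _ _ _), Real.norm_of_nonneg (by positivity), hpow]
  refine (WGMpow_le (by omega) hd F hF p hp).trans ?_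
  calc 54 * √(2 * d) / √n + Real.exp (-n) ≤ 54 * √(2 * d) / √n + (√(n:ℝ))⁻¹ := by gcongr
    _ = (54 * √(2 * d) + 1) * ((√(n:ℝ))⁻¹ * 1) := by ring
    _ ≤ _ := by gcongr

end
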